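/- arXiv:1809.06141 — 2 statements merged into one kernel-verified Lean document; each statement's English description precedes it below -/
import Mathlib

section
/- (Gardner–Gritzmann, seven coplanar directions) Let d ≥ 2 and let 𝓛 be any set of at least seven pairwise distinct lattice lines in ℝ^d all contained in a common 2-dimensional linear subspace. Then every finite convex lattice set F ⊆ ℤ^d is uniquely determined among finite convex lattice sets by its X-rays parallel to the lines of 𝓛. -/
open Set

variable {d : ℕ}

/-- The affine line through the coset `T` of the modulo-`S` quotient, i.e. an affine
line parallel to `S` when `S` is 1-dimensional. -/
def fiber (S : Submodule ℝ (Fin d → ℝ)) (T : (Fin d → ℝ) ⧸ S) : Set (Fin d → ℝ) :=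
  {x | (Submodule.Quotient.mk x : (Fin d → ℝ) ⧸ S) = T}

/-- `F₁` and `F₂` have the same (discrete) X-ray parallel to `S`. -/
def XrayEq (S : Submodule ℝ (Fin d → ℝ)) (F₁ F₂ : Set (Fin d → ℝ)) : Prop :=
  ∀ T : (Fin d → ℝ) ⧸ S, (F₁ ∩ fiber S T).ncard = (F₂ ∩ fiber S T).ncard

/-- `F₁` and `F₂` are tomographically equivalent w.r.t. the family `𝒮` of lines. -/
def TomEq (𝒮 : Set (Submodule ℝ (Fin d → ℝ))) (F₁ F₂ : Set (Fin d → ℝ)) : Prop :=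
  ∀ S ∈ 𝒮, XrayEq S F₁ F₂

/-- A lattice line: a line through the origin spanned by a nonzero integer vector. -/
def IsLatticeLine (S : Submodule ℝ (Fin d → ℝ)) : Prop :=
  ∃ v : Fin d → ℤ, v ≠ 0 ∧ S = Submodule.span ℝ {fun i => (v i : ℝ)}

/-- The canonical embedding of `ℤ^d` into `ℝ^d`. -/
def embed (x : Fin d → ℤ) : Fin d → ℝ := fun i => (x i : ℝ)

/-- The X-ray difference `Δ_𝒮(F₁,F₂)`. -/
noncomputable def xrayDiff (𝒮 : Set (Submodule ℝ (Fin d → ℝ))) (F₁ F₂ : Set (Fin d → ℝ)) : ℕ :=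
  ∑ᶠ S ∈ 𝒮, ∑ᶠ T : (Fin d → ℝ) ⧸ S,
    (((F₁ ∩ fiber S T).ncard : ℤ) - ((F₂ ∩ fiber S T).ncard : ℤ)).natAbs

/-- A convex lattice set: `F = conv(F) ∩ ℤ^d`. -/
def IsConvexLatticeSet (F : Finset (Fin d → ℤ)) : Prop :=
  embed '' ↑F = convexHull ℝ (embed '' ↑F) ∩ Set.range (embed : (Fin d → ℤ) → (Fin d → ℝ))



lemma nt_galois {N : ℕ} (hN : 0 < N) (a : ℕ) (ha : a.Coprime N) (x y z w : ℂ)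
    (hx : x ^ N = 1) (hy : y ^ N = 1) (hz : z ^ N = 1) (hw : w ^ N = 1) (p q : ℤ)
    (h : p * ((x - z) * (y - w)) = q * ((x - y) * (z - w))) :
    p * ((x ^ a - z ^ a) * (y ^ a - w ^ a)) = q * ((x ^ a - y ^ a) * (z ^ a - w ^ a)) := by
  have hζ := Complex.isPrimitiveRoot_exp N hN.ne'
  set ζ := Complex.exp (2 * Real.pi * Complex.I / N) with hζdef
  have : NeZero N := ⟨hN.ne'⟩
  obtain ⟨i, -, rfl⟩ := hζ.eq_pow_of_pow_eq_one hx
  obtain ⟨j, -, rfl⟩ := hζ.eq_pow_of_pow_eq_one hy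
  obtain ⟨k, -, rfl⟩ := hζ.eq_pow_of_pow_eq_one hz
  obtain ⟨l, -, rfl⟩ := hζ.eq_pow_of_pow_eq_one hw
  let Q : Polynomial ℤ := Polynomial.C p * ((Polynomial.X ^ i - Polynomial.X ^ k) *
      (Polynomial.X ^ j - Polynomial.X ^ l)) - Polynomial.C q * ((Polynomial.X ^ i - Polynomial.X ^ j) *
      (Polynomial.X ^ k - Polynomial.X ^ l))
  have hQ : Polynomial.aeval ζ Q = 0 := by
    simp only [Q, map_sub, map_mul, map_pow, Polynomial.aeval_X, Polynomial.aeval_C]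
    simp only [eq_intCast]
    linear_combination h
  have hdvd : minpoly ℤ ζ ∣ Q := minpoly.isIntegrallyClosed_dvd (hζ.isIntegral hN) hQ
  rw [hζ.minpoly_eq_pow_coprime ha] at hdvd
  have hQ2 : Polynomial.aeval (ζ ^ a) Q = 0 := by
    obtain ⟨R, hR⟩ := hdvd
    rw [hR, map_mul, minpoly.aeval, zero_mul]
  simp only [Q, map_sub, map_mul, map_pow, Polynomial.aeval_X, Polynomial.aeval_C] at hQ2
  simp only [eq_intCast] at hQ2
  simp only [← pow_mul] at hQ2 ⊢
  simp only [mul_comm _ a]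
  linear_combination hQ2

/-- cross-ratio comparison -/
lemma nt_cross {N : ℕ} (hN : 0 < N) (a : ℕ) (ha : a.Coprime N) (x y z w : ℂ)
    (hx : x ^ N = 1) (hy : y ^ N = 1) (hz : z ^ N = 1) (hw : w ^ N = 1) (p q : ℤ) (hp : p ≠ 0)
    (hq : q ≠ 0)
    (h : p * ((x - z) * (y - w)) = q * ((x - y) * (z - w))) :
    ((x - z) * (y - w)) * ((x ^ a - y ^ a) * (z ^ a - w ^ a)) =
     ((x - y) * (z - w)) * ((x ^ a - z ^ a) * (y ^ a - w ^ a)) := by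
  have h2 := nt_galois hN a ha x y z w hx hy hz hw p q h
  have hp' : (p : ℂ) ≠ 0 := by exact_mod_cast hp
  have hq' : (q : ℂ) ≠ 0 := by exact_mod_cast hq
  apply mul_left_cancel₀ (mul_ne_zero hp' hq')
  linear_combination (q * ((x ^ a - y ^ a) * (z ^ a - w ^ a))) * h - (q * ((x - y) * (z - w))) * h2

lemma nt_inj {N : ℕ} (a : ℕ) (ha : a.Coprime N) (x y : ℂ)
    (hx : x ^ N = 1) (hy : y ^ N = 1) (h : x ^ a = y ^ a) : x = y := by
  have hy0 : y ≠ 0 ∨ N = 0 := by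
    by_cases hN : N = 0
    · right; exact hN
    · left; rintro rfl; rw [zero_pow hN] at hy; exact zero_ne_one hy
  rcases hy0 with hy0 | rfl
  · have h1 : (x / y) ^ a = 1 := by rw [div_pow, h, div_self (pow_ne_zero _ hy0)]
    have h2 : (x / y) ^ N = 1 := by rw [div_pow, hx, hy, div_one]
    have h3 : orderOf (x / y) ∣ Nat.gcd a N :=
      Nat.dvd_gcd (orderOf_dvd_of_pow_eq_one h1) (orderOf_dvd_of_pow_eq_one h2)
    rw [ha, Nat.dvd_one, orderOf_eq_one_iff] at h3
    exact (div_eq_one_iff_eq hy0).1 h3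
  · have : a = 1 := by simpa using ha
    simpa [this] using h

lemma nt_coef (A B E G : ℂ) (h : Polynomial.C A * Polynomial.X ^ 4 + Polynomial.C B * Polynomial.X ^ 3
       + Polynomial.C E * Polynomial.X + Polynomial.C G = 0) : A = 0 ∧ B = 0 := by
  have c4 := congrArg (fun R => Polynomial.coeff R 4) h
  have c3 := congrArg (fun R => Polynomial.coeff R 3) h
  simp [Polynomial.coeff_X, Polynomial.coeff_C, Polynomial.coeff_X_pow] at c4 c3
  exact ⟨c4, c3⟩

/-- seven roots of unity cannot have all cross ratios rational -/
lemma nt_main (m : ℕ) (hm : 0 < m) (z₀ : Fin 7 → ℂ) (hinj₀ : Function.Injective z₀)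
    (hz₀ : ∀ i, z₀ i ^ m = 1) (D : Fin 7 → Fin 7 → ℤ) (hD : ∀ i j, i ≠ j → D i j ≠ 0)
    (h₀ : ∀ i j k l, (D i j * D k l : ℂ) * ((z₀ i - z₀ k) * (z₀ j - z₀ l)) =
      (D i k * D j l : ℂ) * ((z₀ i - z₀ j) * (z₀ k - z₀ l))) : False := by
  have hne : z₀ 0 ≠ 0 := by
    intro h; have := hz₀ 0; rw [h, zero_pow hm.ne'] at this; exact zero_ne_one this
  obtain ⟨z, hzdef⟩ : ∃ z : Fin 7 → ℂ, ∀ i, z i = z₀ i / z₀ 0 := ⟨_, fun _ => rfl⟩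
  have hinj : Function.Injective z := by
    intro i j hij
    rw [hzdef, hzdef] at hij
    apply hinj₀
    field_simp at hij
    exact hij
  have hz0 : z 0 = 1 := by rw [hzdef, div_self hne]
  have hzm : ∀ i, z i ^ m = 1 := by
    intro i; rw [hzdef, div_pow, hz₀, hz₀, div_one]
  have h : ∀ i j k l, ((D i j * D k l : ℤ) : ℂ) * ((z i - z k) * (z j - z l)) =
      ((D i k * D j l : ℤ) : ℂ) * ((z i - z j) * (z k - z l)) := by
    intro i j k l
    have := h₀ i j k l
    simp only [hzdef]
    push_cast
    field_simp
    linear_combination this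
  clear h₀ hinj₀ hz₀ hzdef
  have hex : ∃ N : ℕ, 0 < N ∧ ∀ i, z i ^ N = 1 := ⟨m, hm, hzm⟩
  classical
  obtain ⟨hN, hzN⟩ := Nat.find_spec hex
  have hmin := fun k (hk : k < Nat.find hex) => Nat.find_min hex hk
  generalize Nat.find hex = N at *
  have hcr : ∀ a : ℕ, a.Coprime N → ∀ i j k l, i ≠ j → k ≠ l → i ≠ k → j ≠ l → 
      ((z i - z k) * (z j - z l)) * ((z i ^ a - z j ^ a) * (z k ^ a - z l ^ a)) =
     ((z i - z j) * (z k - z l)) * ((z i ^ a - z k ^ a) * (z j ^ a - z l ^ a)) := by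
    intro a ha i j k l hij hkl hik hjl
    exact nt_cross hN a ha _ _ _ _ (hzN i) (hzN j) (hzN k) (hzN l) _ _
      (mul_ne_zero (hD _ _ hij) (hD _ _ hkl)) (mul_ne_zero (hD _ _ hik) (hD _ _ hjl)) (h i j k l)
  by_cases h3 : 3 ∣ N
  · obtain ⟨M, rfl⟩ := h3
    have hM : 0 < M := by omega
    obtain ⟨e, he, hco⟩ : ∃ e : ℕ, (e = 1 ∨ e = 2) ∧ (1 + e * M).Coprime (3 * M) := by
      have h1 : ∀ e, (1 + e * M).Coprime M := by intro e; simp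
      have h2 : ∃ e, (e = 1 ∨ e = 2) ∧ (1 + e * M) % 3 ≠ 0 := by
        by_cases hM3 : (1 + M) % 3 = 0
        · exact ⟨2, by simp, by omega⟩
        · exact ⟨1, by simp, by omega⟩
      obtain ⟨e, he, h2⟩ := h2
      refine ⟨e, he, Nat.Coprime.mul_right ?_ (h1 e)⟩
      exact Nat.Coprime.symm ((Nat.Prime.coprime_iff_not_dvd Nat.prime_three).2 (fun hd => h2 (Nat.mod_eq_zero_of_dvd hd)))
    -- the class function
    have hcl : ∀ i, (z i ^ (e * M)) ^ 3 = 1 := by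
      intro i; rw [← pow_mul, show e * M * 3 = 3 * M * e by ring, pow_mul, hzN, one_pow]
    have hroots : ∀ i ∈ (Finset.univ : Finset (Fin 7)), z i ^ (e * M) ∈ Polynomial.nthRootsFinset 3 (1 : ℂ) := by
      intro i _
      rw [Polynomial.mem_nthRootsFinset (by norm_num)]
      exact hcl i
    have hcard : (Polynomial.nthRootsFinset 3 (1 : ℂ)).card * 2 < (Finset.univ : Finset (Fin 7)).card := by
      have := (Complex.isPrimitiveRoot_exp 3 (by norm_num)).card_nthRootsFinset
      rw [this]; simp
    obtain ⟨ε, hε, hε2⟩ := Finset.exists_lt_card_fiber_of_mul_lt_card_of_maps_to hroots hcard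
    obtain ⟨i, j, k, hi, hj, hk, hij, hik, hjk⟩ := Finset.two_lt_card_iff.1 hε2
    simp only [Finset.mem_filter, Finset.mem_univ, true_and] at hi hj hk
    have hε0 : ε ≠ 0 := by
      rintro rfl; rw [Polynomial.mem_nthRootsFinset (by norm_num)] at hε; norm_num at hε
    have hall : ∀ l, z l ^ (e * M) = ε := by
      intro l
      by_cases hl1 : l = i
      · rw [hl1, hi]
      by_cases hl2 : l = j
      · rw [hl2, hj]
      by_cases hl3 : l = k
      · rw [hl3, hk]
      have := hcr _ hco i j k l hij (Ne.symm hl3) hik (Ne.symm hl2)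
      simp only [pow_add, pow_one, hi, hj, hk] at this
      have h1 : z i - z j ≠ 0 := sub_ne_zero.2 (hinj.ne hij)
      have h2 : z i - z k ≠ 0 := sub_ne_zero.2 (hinj.ne hik)
      have h3 : z j - z k ≠ 0 := sub_ne_zero.2 (hinj.ne hjk)
      have h4 : z l ≠ 0 := by
        intro h; have := hzN l; rw [h, zero_pow (by omega)] at this; exact zero_ne_one this
      have h5 : (z i - z j) * (z i - z k) * (z j - z k) * ε * z l * (z l ^ (e * M) - ε) = 0 := by
        linear_combination -this
      have := (mul_eq_zero.1 h5).resolve_left (by positivity)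
      exact sub_eq_zero.1 this
    have hε1 : ε = 1 := by rw [← hall 0, hz0, one_pow]
    apply hmin M (by omega)
    refine ⟨hM, fun l => ?_⟩
    rcases he with rfl | rfl
    · rw [← hε1, ← hall l, one_mul]
    · have := hall l
      have h6 := hzN l
      rw [show 3 * M = 2 * M + M by ring, pow_add, this, hε1, one_mul] at h6
      exact h6
  · have hco : Nat.Coprime 3 N := (Nat.Prime.coprime_iff_not_dvd Nat.prime_three).2 h3
    let α := (z 0 - z 2) * (z 0 ^ 3 - z 1 ^ 3)
    let β := (z 0 - z 1) * (z 0 ^ 3 - z 2 ^ 3)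
    have hα : α ≠ 0 := mul_ne_zero (sub_ne_zero.2 (hinj.ne (by decide)))
      (sub_ne_zero.2 (fun hh => hinj.ne (show (0 : Fin 7) ≠ 1 by decide) (nt_inj 3 hco _ _ (hzN _) (hzN _) hh)))
    let Q : Polynomial ℂ := Polynomial.C α * ((Polynomial.C (z 1) - Polynomial.X) * (Polynomial.C (z 2 ^ 3) - Polynomial.X ^ 3))
      - Polynomial.C β * ((Polynomial.C (z 2) - Polynomial.X) * (Polynomial.C (z 1 ^ 3) - Polynomial.X ^ 3))
    have hQe : ∀ x, Q.eval x = α * ((z 1 - x) * (z 2 ^ 3 - x ^ 3)) - β * ((z 2 - x) * (z 1 ^ 3 - x ^ 3)) := by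
      intro x; simp [Q]
    have hQ0 : ∀ l, Q.eval (z l) = 0 := by
      intro l
      rw [hQe]
      by_cases hl1 : l = 1
      · subst hl1; ring
      by_cases hl2 : l = 2
      · subst hl2; ring
      have := hcr 3 hco 0 1 2 l (by decide) (Ne.symm hl2) (by decide) (Ne.symm hl1)
      simp only [α, β]
      linear_combination this
    have hdeg : Q.natDegree < 7 := by
      have : Q.natDegree ≤ 4 := by
        simp only [Q]; compute_degree
      omega
    have hQz : Q = 0 := Polynomial.eq_zero_of_natDegree_lt_card_of_eval_eq_zero Q hinj hQ0 (by simpa using hdeg)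
    have e4 : Q = Polynomial.C (α - β) * Polynomial.X ^ 4 + Polynomial.C (- α * z 1 + β * z 2) * Polynomial.X ^ 3
       + Polynomial.C (- α * z 2 ^ 3 + β * z 1 ^ 3) * Polynomial.X + Polynomial.C (α * z 1 * z 2 ^ 3 - β * z 2 * z 1 ^ 3) := by
      simp only [Q, map_sub, map_add, map_mul, map_neg]
      ring
    obtain ⟨c4, c3⟩ := nt_coef _ _ _ _ (e4.symm.trans hQz)
    have hab : α = β := by linear_combination c4
    have : α * (z 1 - z 2) = 0 := by rw [← hab] at c3; linear_combination -c3
    exact mul_ne_zero hα (sub_ne_zero.2 (hinj.ne (by decide))) this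
set_option linter.unusedVariables false

/-- cyclic order of four points with respect to a relation -/
def cyc {α : Type*} (R : α → α → Prop) (x w y z : α) : Prop :=
  (R x w ∧ R w y ∧ R y z) ∨ (R w y ∧ R y z ∧ R z x) ∨ (R y z ∧ R z x ∧ R x w) ∨
    (R z x ∧ R x w ∧ R w y)

/-- position relation: left side going up, then right side going down -/
def bf (p q : Prop × ℝ) : Prop :=
  (p.1 ∧ ¬ q.1) ∨ (p.1 ∧ q.1 ∧ p.2 < q.2) ∨ (¬ p.1 ∧ ¬ q.1 ∧ q.2 < p.2)

lemma core_ivt (b e sx mp tx sw mq tw : ℝ) (hbe : b ≤ e)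
    (hb : sw + mq * (b - tw) < sx + mp * (b - tx))
    (he : sx + mp * (e - tx) < sw + mq * (e - tw)) :
    mp < mq ∧ ∃ t, b ≤ t ∧ t ≤ e ∧ sx + mp * (t - tx) = sw + mq * (t - tw) := by
  have h1 : mp < mq := by
    by_contra hcon
    push Not at hcon
    nlinarith
  refine ⟨h1, b + ((sx + mp * (b - tx)) - (sw + mq * (b - tw))) / (mq - mp), ?_, ?_, ?_⟩
  · have : 0 ≤ ((sx + mp * (b - tx)) - (sw + mq * (b - tw))) / (mq - mp) :=
      div_nonneg (by linarith) (by linarith)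
    linarith
  · have : ((sx + mp * (b - tx)) - (sw + mq * (b - tw))) / (mq - mp) ≤ e - b := by
      rw [div_le_iff₀ (by linarith)]; nlinarith
    linarith
  · have : mq - mp ≠ 0 := by linarith
    field_simp
    ring

lemma logic1 (tx ty tw tz : ℝ) (Lx Ly Lw Lz : Prop) (hxy : tx < ty) (hwz : tw < tz)
    (e1 : tx = tw → (Lx ↔ ¬ Lw)) (e2 : tx = tz → (Lx ↔ ¬ Lz)) (e3 : ty = tw → (Ly ↔ ¬ Lw))
    (e4 : ty = tz → (Ly ↔ ¬ Lz))
    (o1 : tx ≤ tz) (o2 : tw ≤ ty) (a1 : tw ≤ tx → ¬ Lx) (a2 : tx ≤ tw → Lw)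
    (a3 : ty ≤ tz → Ly) (a4 : tz ≤ ty → ¬ Lz) :
    cyc bf (Lx, tx) (Lw, tw) (Ly, ty) (Lz, tz) := by
  simp only [cyc, bf]
  by_cases Lx <;> by_cases Ly <;> by_cases Lw <;> by_cases Lz <;> 
    simp_all <;> grind

lemma logic2 (tx ty tw tz : ℝ) (Lx Ly Lw Lz : Prop) (hxy : tx < ty) (hwz : tw < tz)
    (e1 : tx = tw → (Lx ↔ ¬ Lw)) (e2 : tx = tz → (Lx ↔ ¬ Lz)) (e3 : ty = tw → (Ly ↔ ¬ Lw))
    (e4 : ty = tz → (Ly ↔ ¬ Lz))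
    (h : cyc bf (Lx, tx) (Lw, tw) (Ly, ty) (Lz, tz)) :
    (tx ≤ tz ∧ tw ≤ ty) ∧ (tw ≤ tx → ¬ Lx) ∧ (tx ≤ tw → Lw) ∧
    (ty ≤ tz → Ly) ∧ (tz ≤ ty → ¬ Lz) := by
  simp only [cyc, bf] at h
  by_cases Lx <;> by_cases Ly <;> by_cases Lw <;> by_cases Lz <;> 
    simp_all <;> grind

/-- planar core: crossing with a given orientation is the cyclic order -/
lemma core_slope (tx ty tw tz sx sw mp mq : ℝ) (Lx Ly Lw Lz : Prop) (hxy : tx < ty) (hwz : tw < tz)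
    (e1 : tx = tw → (Lx ↔ ¬ Lw)) (e2 : tx = tz → (Lx ↔ ¬ Lz)) (e3 : ty = tw → (Ly ↔ ¬ Lw))
    (e4 : ty = tz → (Ly ↔ ¬ Lz))
    (fx : tw ≤ tx → tx ≤ tz → (Lx → sx < sw + mq * (tx - tw)) ∧ (¬ Lx → sw + mq * (tx - tw) < sx))
    (fy : tw ≤ ty → ty ≤ tz → (Ly → sx + mp * (ty - tx) < sw + mq * (ty - tw)) ∧
      (¬ Ly → sw + mq * (ty - tw) < sx + mp * (ty - tx)))
    (fw : tx ≤ tw → tw ≤ ty → (Lw → sw < sx + mp * (tw - tx)) ∧ (¬ Lw → sx + mp * (tw - tx) < sw))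
    (fz : tx ≤ tz → tz ≤ ty → (Lz → sw + mq * (tz - tw) < sx + mp * (tz - tx)) ∧
      (¬ Lz → sx + mp * (tz - tx) < sw + mq * (tz - tw))) :
    (mp < mq ∧ ∃ t, tx ≤ t ∧ t ≤ ty ∧ tw ≤ t ∧ t ≤ tz ∧ sx + mp * (t - tx) = sw + mq * (t - tw)) ↔
    cyc bf (Lx, tx) (Lw, tw) (Ly, ty) (Lz, tz) := by
  constructor
  · rintro ⟨hm, t, h1, h2, h3, h4, heq⟩
    refine logic1 _ _ _ _ _ _ _ _ hxy hwz e1 e2 e3 e4 (by linarith) (by linarith) ?_ ?_ ?_ ?_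
    · intro h hL
      have := (fx h (by linarith)).1 hL
      nlinarith
    · intro h
      by_contra hL
      have := (fw h (by linarith)).2 hL
      nlinarith
    · intro h
      by_contra hL
      have := (fy (by linarith) h).2 hL
      nlinarith
    · intro h hL
      have := (fz (by linarith) h).1 hL
      nlinarith
  · intro hc
    obtain ⟨⟨o1, o2⟩, a1, a2, a3, a4⟩ := logic2 _ _ _ _ _ _ _ _ hxy hwz e1 e2 e3 e4 hc
    obtain ⟨b, b1, b2, b3, b4, hb⟩ : ∃ b, tx ≤ b ∧ tw ≤ b ∧ (b ≤ ty) ∧ (b ≤ tz) ∧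
        sw + mq * (b - tw) < sx + mp * (b - tx) := by
      rcases le_total tw tx with h | h
      · exact ⟨tx, le_rfl, h, hxy.le, o1, by have := (fx h o1).2 (a1 h); linarith⟩
      · exact ⟨tw, h, le_rfl, o2, hwz.le, by have := (fw h o2).1 (a2 h); linarith⟩
    obtain ⟨e, g1, g2, g3, hbe, he⟩ : ∃ e, (e ≤ ty) ∧ (e ≤ tz) ∧ (e = ty ∨ e = tz) ∧ b ≤ e ∧
        sx + mp * (e - tx) < sw + mq * (e - tw) := by
      rcases le_total ty tz with h | h
      · exact ⟨ty, le_rfl, h, Or.inl rfl, b3, (fy o2 h).1 (a3 h)⟩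
      · exact ⟨tz, h, le_rfl, Or.inr rfl, b4, (fz o1 h).2 (a4 h)⟩
    obtain ⟨hm, t, t1, t2, ht⟩ := core_ivt b e sx mp tx sw mq tw hbe hb he
    exact ⟨hm, t, by linarith, by linarith, by linarith, by linarith, ht⟩

/-- crossing of segments in coordinates -/
def crs (tx sx ty sy tw sw tz sz : ℝ) : Prop :=
  ∃ l n : ℝ, 0 ≤ l ∧ l ≤ 1 ∧ 0 ≤ n ∧ n ≤ 1 ∧ tx + l * (ty - tx) = tw + n * (tz - tw) ∧
    sx + l * (sy - sx) = sw + n * (sz - sw)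

lemma crs_swap1 {tx sx ty sy tw sw tz sz : ℝ} (h : crs tx sx ty sy tw sw tz sz) :
    crs ty sy tx sx tw sw tz sz := by
  obtain ⟨l, n, h1, h2, h3, h4, h5, h6⟩ := h
  exact ⟨1 - l, n, by linarith, by linarith, h3, h4, by linarith, by linarith⟩

lemma crs_swap2 {tx sx ty sy tw sw tz sz : ℝ} (h : crs tx sx ty sy tw sw tz sz) :
    crs tx sx ty sy tz sz tw sw := by
  obtain ⟨l, n, h1, h2, h3, h4, h5, h6⟩ := h
  exact ⟨l, 1 - n, h1, h2, by linarith, by linarith, by linarith, by linarith⟩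

/-- `a` is on its side of the segment `bc` -/
def sideOf (ta sa : ℝ) (La : Prop) (tb sb tc sc : ℝ) : Prop :=
  ∀ n : ℝ, 0 ≤ n → n ≤ 1 → tb + n * (tc - tb) = ta →
    (La → sa < sb + n * (sc - sb)) ∧ (¬ La → sb + n * (sc - sb) < sa)

lemma sideOf_swap {ta sa : ℝ} {La : Prop} {tb sb tc sc : ℝ} (h : sideOf ta sa La tb sb tc sc) :
    sideOf ta sa La tc sc tb sb := by
  intro n h0 h1 he
  have := h (1 - n) (by linarith) (by linarith) (by linarith)
  have e : sb + (1 - n) * (sc - sb) = sc + n * (sb - sc) := by ring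
  rwa [e] at this

lemma sideOf_slope {ta sa : ℝ} {La : Prop} {tb sb tc m : ℝ} (hbc : tb < tc)
    (h : sideOf ta sa La tb sb tc (sb + m * (tc - tb))) (h1 : tb ≤ ta) (h2 : ta ≤ tc) :
    (La → sa < sb + m * (ta - tb)) ∧ (¬ La → sb + m * (ta - tb) < sa) := by
  have hp : 0 < tc - tb := by linarith
  have := h ((ta - tb) / (tc - tb)) (div_nonneg (by linarith) hp.le)
    (by rw [div_le_one hp]; linarith) (by field_simp; ring)
  have e : sb + (ta - tb) / (tc - tb) * (sb + m * (tc - tb) - sb) = sb + m * (ta - tb) := by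
    field_simp; ring
  rwa [e] at this

lemma core_pos (tx ty tw tz sx sy sw sz : ℝ) (Lx Ly Lw Lz : Prop) (hxy : tx < ty) (hwz : tw < tz)
    (e1 : tx = tw → (Lx ↔ ¬ Lw)) (e2 : tx = tz → (Lx ↔ ¬ Lz)) (e3 : ty = tw → (Ly ↔ ¬ Lw))
    (e4 : ty = tz → (Ly ↔ ¬ Lz))
    (fx : sideOf tx sx Lx tw sw tz sz) (fy : sideOf ty sy Ly tw sw tz sz)
    (fw : sideOf tw sw Lw tx sx ty sy) (fz : sideOf tz sz Lz tx sx ty sy) :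
    (crs tx sx ty sy tw sw tz sz ∧ (sy - sx) * (tz - tw) - (ty - tx) * (sz - sw) < 0) ↔
    cyc bf (Lx, tx) (Lw, tw) (Ly, ty) (Lz, tz) := by
  have p1 : 0 < ty - tx := by linarith
  have p2 : 0 < tz - tw := by linarith
  obtain ⟨mp, rfl⟩ : ∃ mp, sy = sx + mp * (ty - tx) := ⟨(sy - sx) / (ty - tx), by field_simp; ring⟩
  obtain ⟨mq, rfl⟩ : ∃ mq, sz = sw + mq * (tz - tw) := ⟨(sz - sw) / (tz - tw), by field_simp; ring⟩
  rw [← core_slope tx ty tw tz sx sw mp mq Lx Ly Lw Lz hxy hwz e1 e2 e3 e4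
    (sideOf_slope hwz fx) (sideOf_slope hwz fy) (sideOf_slope hxy fw) (sideOf_slope hxy fz)]
  have e : (sx + mp * (ty - tx) - sx) * (tz - tw) - (ty - tx) * (sw + mq * (tz - tw) - sw)
      = (mp - mq) * ((ty - tx) * (tz - tw)) := by ring
  rw [e]
  have hpp := mul_pos p1 p2
  have e' : (mp - mq) * ((ty - tx) * (tz - tw)) < 0 ↔ mp < mq := by
    constructor
    · intro h; by_contra hc; push Not at hc; nlinarith
    · intro h; nlinarith
  rw [e', and_comm]
  refine and_congr_right (fun _ => ?_)
  constructor
  · rintro ⟨l, n, h1, h2, h3, h4, h5, h6⟩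
    refine ⟨tx + l * (ty - tx), by nlinarith, by nlinarith, by rw [h5]; nlinarith, by rw [h5]; nlinarith, ?_⟩
    have : mq * (tx + l * (ty - tx) - tw) = mq * (n * (tz - tw)) := by rw [h5]; ring
    rw [this]; linarith
  · rintro ⟨t, h1, h2, h3, h4, h5⟩
    refine ⟨(t - tx) / (ty - tx), (t - tw) / (tz - tw), div_nonneg (by linarith) p1.le,
      by rw [div_le_one p1]; linarith, div_nonneg (by linarith) p2.le,
      by rw [div_le_one p2]; linarith, by field_simp; ring, ?_⟩
    have a1 : sx + (t - tx) / (ty - tx) * (sx + mp * (ty - tx) - sx) = sx + mp * (t - tx) := by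
      field_simp; ring
    have a2 : sw + (t - tw) / (tz - tw) * (sw + mq * (tz - tw) - sw) = sw + mq * (t - tw) := by
      field_simp; ring
    rw [a1, a2, h5]

lemma bf_rev (p q : Prop) (a b : ℝ) : bf (¬ p, a) (¬ q, b) ↔ bf (q, b) (p, a) := by
  simp only [bf]
  tauto

lemma cyc_rev (tx ty tw tz : ℝ) (Lx Ly Lw Lz : Prop) :
    cyc bf (Lx, tx) (Lw, tw) (Ly, ty) (Lz, tz) ↔
    cyc bf (¬ Lz, tz) (¬ Ly, ty) (¬ Lw, tw) (¬ Lx, tx) := by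
  simp only [cyc, bf_rev]
  tauto

lemma cyc_rot {α : Type*} {R : α → α → Prop} {x w y z : α} : cyc R x w y z ↔ cyc R w y z x := by
  simp only [cyc]
  tauto

lemma crs_swap {tx sx ty sy tw sw tz sz : ℝ} (h : crs tx sx ty sy tw sw tz sz) :
    crs tw sw tz sz tx sx ty sy := by
  obtain ⟨l, n, h1, h2, h3, h4, h5, h6⟩ := h
  exact ⟨n, l, h3, h4, h1, h2, h5.symm, h6.symm⟩

lemma crs_degen (tx ty tw tz sx sy sw sz : ℝ) (Lx Ly : Prop) (hxy : tx = ty) (hL : Lx ↔ Ly)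
    (fx : sideOf tx sx Lx tw sw tz sz) (fy : sideOf ty sy Ly tw sw tz sz) :
    ¬ crs tx sx ty sy tw sw tz sz := by
  rintro ⟨l, n, h1, h2, h3, h4, h5, h6⟩
  subst hxy
  have a := fx n h3 h4 (by linarith)
  have b := fy n h3 h4 (by linarith)
  rw [← h6] at a b
  by_cases h : Lx
  · have a := a.1 h
    have b := b.1 (hL.1 h)
    rcases le_total sx sy with h | h <;> nlinarith
  · have a := a.2 h
    have b := b.2 (fun h' => h (hL.2 h'))
    rcases le_total sx sy with h | h <;> nlinarith

lemma cyc_degen (tx ty tw tz : ℝ) (Lx Ly Lw Lz : Prop) (hxy : tx = ty) (hL : Lx ↔ Ly) :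
    ¬ cyc bf (Lx, tx) (Lw, tw) (Ly, ty) (Lz, tz) := by
  subst hxy
  simp only [cyc, bf]
  by_cases Lx <;> by_cases Ly <;> by_cases Lw <;> by_cases Lz <;> 
    simp_all <;> grind

lemma cyc_degen2 (tx ty tw tz : ℝ) (Lx Ly Lw Lz : Prop) (hwz : tw = tz) (hL : Lw ↔ Lz) :
    ¬ cyc bf (Lx, tx) (Lw, tw) (Ly, ty) (Lz, tz) := by
  subst hwz
  simp only [cyc, bf]
  by_cases Lx <;> by_cases Ly <;> by_cases Lw <;> by_cases Lz <;> 
    simp_all <;> grind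

/-- neg crossing -/
lemma core_all (tx ty tw tz sx sy sw sz : ℝ) (Lx Ly Lw Lz : Prop)
    (hxy : tx = ty → (Lx ↔ Ly)) (hwz : tw = tz → (Lw ↔ Lz))
    (e1 : tx = tw → (Lx ↔ ¬ Lw)) (e2 : tx = tz → (Lx ↔ ¬ Lz)) (e3 : ty = tw → (Ly ↔ ¬ Lw))
    (e4 : ty = tz → (Ly ↔ ¬ Lz))
    (fx : sideOf tx sx Lx tw sw tz sz) (fy : sideOf ty sy Ly tw sw tz sz)
    (fw : sideOf tw sw Lw tx sx ty sy) (fz : sideOf tz sz Lz tx sx ty sy) :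
    (crs tx sx ty sy tw sw tz sz ∧ (sy - sx) * (tz - tw) - (ty - tx) * (sz - sw) < 0) ↔
    cyc bf (Lx, tx) (Lw, tw) (Ly, ty) (Lz, tz) := by
  rcases lt_trichotomy tx ty with h1 | h1 | h1
  · rcases lt_trichotomy tw tz with h2 | h2 | h2
    · exact core_pos _ _ _ _ _ _ _ _ _ _ _ _ h1 h2 e1 e2 e3 e4 fx fy fw fz
    · exact iff_of_false (fun h => crs_degen _ _ _ _ _ _ _ _ _ _ h2 (hwz h2) fw fz (crs_swap h.1))
        (cyc_degen2 _ _ _ _ _ _ _ _ h2 (hwz h2))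
    · have := core_pos tz tw tx ty sz sw sx sy Lz Lw Lx Ly h2 h1 (fun h => iff_not_comm.1 (e2 h.symm))
        (fun h => iff_not_comm.1 (e4 h.symm)) (fun h => iff_not_comm.1 (e1 h.symm))
        (fun h => iff_not_comm.1 (e3 h.symm)) fz fw (sideOf_swap fx) (sideOf_swap fy)
      rw [cyc_rot] at this
      rw [← this]
      refine and_congr ⟨fun h => crs_swap (crs_swap2 h), fun h => crs_swap2 (crs_swap h)⟩ ?_
      rw [show (sy - sx) * (tz - tw) - (ty - tx) * (sz - sw) =
        (sw - sz) * (ty - tx) - (tw - tz) * (sy - sx) by ring]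
  · exact iff_of_false (fun h => crs_degen _ _ _ _ _ _ _ _ _ _ h1 (hxy h1) fx fy h.1)
        (cyc_degen _ _ _ _ _ _ _ _ h1 (hxy h1))
  · rcases lt_trichotomy tw tz with h2 | h2 | h2
    · have := core_pos tw tz ty tx sw sz sy sx Lw Lz Ly Lx h2 h1 (fun h => iff_not_comm.1 (e3 h.symm))
        (fun h => iff_not_comm.1 (e1 h.symm)) (fun h => iff_not_comm.1 (e4 h.symm))
        (fun h => iff_not_comm.1 (e2 h.symm)) (sideOf_swap fw) (sideOf_swap fz) fy fx
      rw [← cyc_rot] at this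
      rw [← this]
      refine and_congr ⟨fun h => crs_swap (crs_swap1 h), fun h => crs_swap1 (crs_swap h)⟩ ?_
      rw [show (sy - sx) * (tz - tw) - (ty - tx) * (sz - sw) =
        (sz - sw) * (tx - ty) - (tz - tw) * (sx - sy) by ring]
    · exact iff_of_false (fun h => crs_degen _ _ _ _ _ _ _ _ _ _ h2 (hwz h2) fw fz (crs_swap h.1))
        (cyc_degen2 _ _ _ _ _ _ _ _ h2 (hwz h2))
    · have := core_pos ty tx tz tw sy sx sz sw Ly Lx Lz Lw h1 h2 e4 e3 e2 e1
        (sideOf_swap fy) (sideOf_swap fx) (sideOf_swap fz) (sideOf_swap fw)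
      rw [cyc_rot, cyc_rot] at this
      rw [← this]
      refine and_congr ⟨fun h => crs_swap1 (crs_swap2 h), fun h => crs_swap2 (crs_swap1 h)⟩ ?_
      rw [show (sy - sx) * (tz - tw) - (ty - tx) * (sz - sw) =
        (sx - sy) * (tw - tz) - (tx - ty) * (sw - sz) by ring]
set_option linter.unusedVariables false

/-- transversal coordinate -/
def tt (u x : ℝ × ℝ) : ℝ := u.1 * x.2 - u.2 * x.1
/-- coordinate along the direction -/
def ss (u x : ℝ × ℝ) : ℝ := u.1 * x.1 + u.2 * x.2

/-- the two difference sets -/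
noncomputable def DD (F : Bool → Finset (ℝ × ℝ)) (b : Bool) : Finset (ℝ × ℝ) := by
  classical exact F b \ F (!b)

lemma mem_DD {F : Bool → Finset (ℝ × ℝ)} {b : Bool} {x : ℝ × ℝ} :
    x ∈ DD F b ↔ x ∈ F b ∧ x ∉ F (!b) := by
  classical simp [DD]

/-- planar configuration -/
structure Cfg (F : Bool → Finset (ℝ × ℝ)) (K : Bool → Set (ℝ × ℝ)) : Prop where
  conv : ∀ b, Convex ℝ (K b)
  sub : ∀ b, ∀ x ∈ F b, x ∈ K b
  hull : ∀ b, ∀ x ∈ F b, x ∈ K (!b) → x ∈ F (!b)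

/-- equal X-rays in direction `u` -/
def XR (F : Bool → Finset (ℝ × ℝ)) (u : ℝ × ℝ) : Prop :=
  ∀ c : ℝ, ((F true).filter (fun x => tt u x = c)).card = ((F false).filter (fun x => tt u x = c)).card

/-- being on the left side -/
def LL (F : Bool → Finset (ℝ × ℝ)) (u x : ℝ × ℝ) : Prop :=
  ∃ b, x ∈ DD F b ∧ ∃ y ∈ DD F (!b), tt u y = tt u x ∧ ss u x < ss u y

/-- oriented crossing -/
def XX (x w y z : ℝ × ℝ) : Prop :=
  crs x.2 x.1 y.2 y.1 w.2 w.1 z.2 z.1 ∧ (y.1 - x.1) * (z.2 - w.2) - (y.2 - x.2) * (z.1 - w.1) < 0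

/-- position relation for direction `u` -/
def BB (F : Bool → Finset (ℝ × ℝ)) (u x y : ℝ × ℝ) : Prop := bf (LL F u x, tt u x) (LL F u y, tt u y)

lemma eq_of_tt_ss {u x y : ℝ × ℝ} (hu : u ≠ 0) (h1 : tt u x = tt u y) (h2 : ss u x = ss u y) : x = y := by
  have hp : 0 < u.1 ^ 2 + u.2 ^ 2 := by
    rcases eq_or_ne u.1 0 with h | h
    · have : u.2 ≠ 0 := fun h' => hu (Prod.ext h h')
      positivity
    · positivity
  simp only [tt, ss] at h1 h2
  have a1 : (u.1 ^ 2 + u.2 ^ 2) * (x.1 - y.1) = 0 := by linear_combination u.1 * h2 - u.2 * h1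
  have a2 : (u.1 ^ 2 + u.2 ^ 2) * (x.2 - y.2) = 0 := by linear_combination u.2 * h2 + u.1 * h1
  have b1 := (mul_eq_zero.1 a1).resolve_left hp.ne'
  have b2 := (mul_eq_zero.1 a2).resolve_left hp.ne'
  exact Prod.ext (by linarith) (by linarith)

section
variable {F : Bool → Finset (ℝ × ℝ)} {K : Bool → Set (ℝ × ℝ)} {u : ℝ × ℝ}

lemma XR_DD (hX : XR F u) (b : Bool) (c : ℝ) :
    ((DD F b).filter (fun x => tt u x = c)).card = ((DD F (!b)).filter (fun x => tt u x = c)).card := by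
  classical
  have key : ∀ A B : Finset (ℝ × ℝ), A.card = B.card → (A \ B).card = (B \ A).card := by
    intro A B h
    have h1 := Finset.card_sdiff_add_card_inter A B
    have h2 := Finset.card_sdiff_add_card_inter B A
    rw [Finset.inter_comm] at h2
    omega
  have e : ∀ b, (DD F b).filter (fun x => tt u x = c) =
      (F b).filter (fun x => tt u x = c) \ (F (!b)).filter (fun x => tt u x = c) := by
    intro b; ext x; simp only [Finset.mem_filter, mem_DD, Finset.mem_sdiff]; tauto
  rw [e, e, Bool.not_not]
  apply key
  cases b
  · exact (hX c).symm
  · exact hX c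

lemma partner (hX : XR F u) {b : Bool} {x : ℝ × ℝ} (hx : x ∈ DD F b) :
    ∃ y ∈ DD F (!b), tt u y = tt u x := by
  have h := XR_DD hX b (tt u x)
  have : 0 < ((DD F b).filter (fun y => tt u y = tt u x)).card :=
    Finset.card_pos.2 ⟨x, Finset.mem_filter.2 ⟨hx, rfl⟩⟩
  rw [h] at this
  obtain ⟨y, hy⟩ := Finset.card_pos.1 this
  exact ⟨y, Finset.mem_filter.1 hy⟩

lemma DD_color {b b' : Bool} {x : ℝ × ℝ} (h : x ∈ DD F b) (h' : x ∈ DD F b') : b = b' := by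
  rw [mem_DD] at h h'
  cases b <;> cases b' <;> simp_all

lemma DD_notK (hc : Cfg F K) {b : Bool} {x : ℝ × ℝ} (h : x ∈ DD F b) : x ∉ K (!b) := by
  rw [mem_DD] at h
  exact fun hk => h.2 (hc.hull b x h.1 hk)

lemma DD_K (hc : Cfg F K) {b : Bool} {x : ℝ × ℝ} (h : x ∈ DD F b) : x ∈ K b := by
  rw [mem_DD] at h
  exact hc.sub b x h.1

/-- dichotomy -/
lemma no_between (hc : Cfg F K) (hu : u ≠ 0) {b : Bool} {x k k' : ℝ × ℝ} (h : x ∈ DD F b)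
    (hk : k ∈ K (!b)) (hk' : k' ∈ K (!b)) (e : tt u k = tt u x) (e' : tt u k' = tt u x)
    (h1 : ss u k ≤ ss u x) (h2 : ss u x ≤ ss u k') : False := by
  apply DD_notK hc h
  have hseg := (hc.conv (!b)).segment_subset hk hk'
  rcases eq_or_lt_of_le (h1.trans h2) with h3 | h3
  · have : x = k := eq_of_tt_ss hu e.symm (by linarith)
    rw [this]; exact hk
  · apply hseg
    rw [segment_eq_image]
    have hp : 0 < ss u k' - ss u k := by linarith
    refine ⟨(ss u x - ss u k) / (ss u k' - ss u k), ⟨div_nonneg (by linarith) hp.le, by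
      rw [div_le_one hp]; linarith⟩, ?_⟩
    set l := (ss u x - ss u k) / (ss u k' - ss u k) with hl
    have hl' : l * (ss u k' - ss u k) = ss u x - ss u k := by rw [hl]; field_simp
    apply eq_of_tt_ss hu
    · simp only [tt, Prod.fst_add, Prod.snd_add, Prod.smul_fst, Prod.smul_snd, smul_eq_mul] at e e' ⊢
      linear_combination (1 - l) * e + l * e'
    · simp only [ss, Prod.fst_add, Prod.snd_add, Prod.smul_fst, Prod.smul_snd, smul_eq_mul] at hl' ⊢
      linear_combination hl'

lemma LL_spec (hc : Cfg F K) (hu : u ≠ 0) {b : Bool} {x : ℝ × ℝ} (h : x ∈ DD F b) (hL : LL F u x)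
    {k : ℝ × ℝ} (hk : k ∈ K (!b)) (e : tt u k = tt u x) : ss u x < ss u k := by
  obtain ⟨b', hb', y, hy, ht, hs⟩ := hL
  obtain rfl := DD_color h hb'
  by_contra hcon
  push Not at hcon
  exact no_between hc hu h hk (DD_K hc hy) e ht hcon hs.le

lemma nLL_spec (hc : Cfg F K) (hX : XR F u) (hu : u ≠ 0) {b : Bool} {x : ℝ × ℝ} (h : x ∈ DD F b)
    (hL : ¬ LL F u x) {k : ℝ × ℝ} (hk : k ∈ K (!b)) (e : tt u k = tt u x) : ss u k < ss u x := by
  obtain ⟨y, hy, ht⟩ := partner hX h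
  have h1 : ss u y ≤ ss u x := by
    by_contra hcon
    push Not at hcon
    exact hL ⟨b, h, y, hy, ht, hcon⟩
  by_contra hcon
  push Not at hcon
  exact no_between hc hu h (DD_K hc hy) hk ht e h1 hcon

lemma LL_flip (hc : Cfg F K) (hX : XR F u) (hu : u ≠ 0) {b : Bool} {x y : ℝ × ℝ} (hx : x ∈ DD F b)
    (hy : y ∈ DD F (!b)) (e : tt u y = tt u x) : LL F u y ↔ ¬ LL F u x := by
  have hx' : x ∈ DD F (!!b) := by rwa [Bool.not_not]
  constructor
  · intro h1 h2
    have a := LL_spec hc hu hx h2 (DD_K hc hy) e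
    have b := LL_spec hc hu hy h1 (DD_K hc hx') e.symm
    linarith
  · intro h
    exact ⟨!b, hy, x, hx', e.symm, nLL_spec hc hX hu hx h (DD_K hc hy) e⟩

lemma LL_same (hc : Cfg F K) (hX : XR F u) (hu : u ≠ 0) {b : Bool} {x y : ℝ × ℝ} (hx : x ∈ DD F b)
    (hy : y ∈ DD F b) (e : tt u x = tt u y) : LL F u x ↔ LL F u y := by
  obtain ⟨z, hz, hzt⟩ := partner hX hx
  have a := LL_flip hc hX hu hx hz hzt
  have b := LL_flip hc hX hu hy hz (hzt.trans e)
  tauto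

lemma side_DD (hc : Cfg F K) (hX : XR F u) (hu : u ≠ 0) {b : Bool} {x w z : ℝ × ℝ} (hx : x ∈ DD F b)
    (hw : w ∈ K (!b)) (hz : z ∈ K (!b)) :
    sideOf (tt u x) (ss u x) (LL F u x) (tt u w) (ss u w) (tt u z) (ss u z) := by
  intro n h0 h1 e
  have hk : w + n • (z - w) ∈ K (!b) := (hc.conv (!b)).add_smul_sub_mem hw hz ⟨h0, h1⟩
  have ht : tt u (w + n • (z - w)) = tt u w + n * (tt u z - tt u w) := by
    simp [tt]; ring
  have hs : ss u (w + n • (z - w)) = ss u w + n * (ss u z - ss u w) := by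
    simp [ss]; ring
  rw [← hs]
  exact ⟨fun h => LL_spec hc hu hx h hk (by rw [ht, e]), fun h => nLL_spec hc hX hu hx h hk (by rw [ht, e])⟩

/-- main geometric lemma -/
lemma XX_iff (hc : Cfg F K) (hX : XR F u) (hu : u ≠ 0) {b : Bool} {x y w z : ℝ × ℝ} (hx : x ∈ DD F b)
    (hy : y ∈ DD F b) (hw : w ∈ DD F (!b)) (hz : z ∈ DD F (!b)) :
    XX x w y z ↔ cyc (BB F u) x w y z := by
  have hp : 0 < u.1 ^ 2 + u.2 ^ 2 := by
    rcases eq_or_ne u.1 0 with h | h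
    · have : u.2 ≠ 0 := fun h' => hu (Prod.ext h h')
      positivity
    · positivity
  have hx' : x ∈ K (!!b) := by rw [Bool.not_not]; exact DD_K hc hx
  have hy' : y ∈ K (!!b) := by rw [Bool.not_not]; exact DD_K hc hy
  have key := core_all (tt u x) (tt u y) (tt u w) (tt u z) (ss u x) (ss u y) (ss u w) (ss u z)
    (LL F u x) (LL F u y) (LL F u w) (LL F u z)
    (LL_same hc hX hu hx hy) (LL_same hc hX hu hw hz)
    (fun e => iff_not_comm.1 (LL_flip hc hX hu hx hw e.symm))
    (fun e => iff_not_comm.1 (LL_flip hc hX hu hx hz e.symm))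
    (fun e => iff_not_comm.1 (LL_flip hc hX hu hy hw e.symm))
    (fun e => iff_not_comm.1 (LL_flip hc hX hu hy hz e.symm))
    (side_DD hc hX hu hx (DD_K hc hw) (DD_K hc hz))
    (side_DD hc hX hu hy (DD_K hc hw) (DD_K hc hz))
    (side_DD hc hX hu hw hx' hy') (side_DD hc hX hu hz hx' hy')
  have e1 : cyc (BB F u) x w y z ↔ cyc bf (LL F u x, tt u x) (LL F u w, tt u w) (LL F u y, tt u y)
    (LL F u z, tt u z) := Iff.rfl
  rw [e1, ← key, XX]
  refine and_congr ?_ ?_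
  · constructor
    · rintro ⟨l, n, h1, h2, h3, h4, h5, h6⟩
      refine ⟨l, n, h1, h2, h3, h4, ?_, ?_⟩
      · simp only [tt]; linear_combination u.1 * h5 - u.2 * h6
      · simp only [ss]; linear_combination u.2 * h5 + u.1 * h6
    · rintro ⟨l, n, h1, h2, h3, h4, h5, h6⟩
      refine ⟨l, n, h1, h2, h3, h4, ?_, ?_⟩
      · simp only [tt, ss] at h5 h6
        apply mul_left_cancel₀ hp.ne'
        linear_combination u.1 * h5 + u.2 * h6
      · simp only [tt, ss] at h5 h6
        apply mul_left_cancel₀ hp.ne'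
        linear_combination u.1 * h6 - u.2 * h5
  · have : (ss u y - ss u x) * (tt u z - tt u w) - (tt u y - tt u x) * (ss u z - ss u w) =
      (u.1 ^ 2 + u.2 ^ 2) * ((y.1 - x.1) * (z.2 - w.2) - (y.2 - x.2) * (z.1 - w.1)) := by
      simp only [tt, ss]; ring
    rw [this]
    constructor
    · intro h; exact mul_neg_of_pos_of_neg hp h
    · intro h; by_contra hcon; push Not at hcon; nlinarith [mul_nonneg hp.le hcon]

end
set_option linter.unusedVariables false

lemma exists_runs (S : Finset ℝ) (ε : ℝ → Bool) : ∃ (r : ℕ) (j : ℝ → ℕ) (e0 : Bool),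
    (∀ t ∈ S, j t < r) ∧ (∀ t ∈ S, ∀ t' ∈ S, t ≤ t' → j t ≤ j t') ∧ (∀ i < r, ∃ t ∈ S, j t = i) ∧
    (∀ t ∈ S, ε t = xor e0 (j t).bodd) := by
  classical
  induction S using Finset.induction_on_max with
  | empty => exact ⟨0, fun _ => 0, true, by simp, by simp, by simp, by simp⟩
  | insert a S hS ih =>
    obtain ⟨r, j, e0, h1, h2, h3, h4⟩ := ih
    have hne : ∀ t ∈ S, t ≠ a := fun t ht => (hS t ht).ne
    rcases Nat.eq_zero_or_pos r with rfl | hr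
    · have hS0 : S = ∅ := by
        apply Finset.eq_empty_of_forall_notMem
        intro t ht; have := h1 t ht; omega
      subst hS0
      exact ⟨1, fun _ => 0, ε a, by simp, by simp, by simp, by simp⟩
    · obtain ⟨k, hk1, hk2, hk3, hk4⟩ : ∃ k, (k = r - 1 ∨ k = r) ∧ ε a = xor e0 k.bodd ∧ r ≤ k + 1 ∧ k ≤ r := by
        by_cases h : ε a = xor e0 (r - 1).bodd
        · exact ⟨r - 1, Or.inl rfl, h, by omega, by omega⟩
        · refine ⟨r, Or.inr rfl, ?_, by omega, by omega⟩
          have : r = (r - 1) + 1 := by omega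
          rw [this, Nat.bodd_succ]
          revert h
          cases ε a <;> cases e0 <;> cases (r - 1).bodd <;> simp
      refine ⟨k + 1, fun t => if t = a then k else j t, e0, ?_, ?_, ?_, ?_⟩
      · intro t ht
        by_cases h : t = a
        · simp [h]
        · have := h1 t ((Finset.mem_insert.1 ht).resolve_left h)
          simp only [h, if_false]; omega
      · intro t ht t' ht' hle
        by_cases h : t = a <;> by_cases h' : t' = a
        · simp [h, h']
        · have := hS t' ((Finset.mem_insert.1 ht').resolve_left h')
          subst h; linarith
        · have := h1 t ((Finset.mem_insert.1 ht).resolve_left h)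
          simp only [h, h', if_false, if_true]; omega
        · simp only [h, h', if_false]
          exact h2 t ((Finset.mem_insert.1 ht).resolve_left h) t' ((Finset.mem_insert.1 ht').resolve_left h') hle
      · intro i hi
        by_cases hik : i = k
        · exact ⟨a, Finset.mem_insert_self _ _, by simp [hik]⟩
        · obtain ⟨t, ht, hti⟩ := h3 i (by omega)
          exact ⟨t, Finset.mem_insert_of_mem ht, by simp [hne t ht, hti]⟩
      · intro t ht
        by_cases h : t = a
        · subst h; simp [hk2]
        · simp only [h, if_false]
          exact h4 t ((Finset.mem_insert.1 ht).resolve_left h)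

/-- numbering of arcs -/
structure ArcNum (F : Bool → Finset (ℝ × ℝ)) (u : ℝ × ℝ) (r : ℕ) (P : ℝ × ℝ → ℕ) : Prop where
  lt : ∀ b, ∀ x ∈ DD F b, P x < 2 * r
  par : ∃ e0 : Bool, ∀ b, ∀ x ∈ DD F b, b = xor e0 (P x).bodd
  surj : ∀ i < 2 * r, ∃ b, ∃ x ∈ DD F b, P x = i
  ord : ∀ b, ∀ x ∈ DD F b, ∀ w ∈ DD F (!b), BB F u x w ↔ P x < P w
  mono : ∃ J : ℝ × ℝ → ℕ, (∀ b, ∀ x ∈ DD F b, J x < r ∧ (P x = J x ∨ P x + J x + 1 = 2 * r)) ∧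
    ∀ b, ∀ x ∈ DD F b, ∀ b', ∀ y ∈ DD F b', tt u x ≤ tt u y → J x ≤ J y

section
variable {F : Bool → Finset (ℝ × ℝ)} {K : Bool → Set (ℝ × ℝ)} {u : ℝ × ℝ}

lemma exists_num (hc : Cfg F K) (hX : XR F u) (hu : u ≠ 0) : ∃ r P, ArcNum F u r P := by
  classical
  let ε : ℝ → Bool := fun t => decide (∃ x ∈ DD F true, tt u x = t ∧ LL F u x)
  obtain ⟨r, j, e0, h1, h2, h3, h4⟩ := exists_runs ((DD F true ∪ DD F false).image (tt u)) ε
  have hmem : ∀ b, ∀ x ∈ DD F b, tt u x ∈ (DD F true ∪ DD F false).image (tt u) := by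
    intro b x hx
    apply Finset.mem_image_of_mem
    cases b <;> simp [hx]
  have hε : ∀ b, ∀ x ∈ DD F b, ε (tt u x) = if LL F u x then b else !b := by
    intro b x hx
    by_cases hL : LL F u x
    · simp only [hL, if_true]
      cases b
      · simp only [ε, decide_eq_false_iff_not]
        rintro ⟨y, hy, hyt, hyL⟩
        exact (LL_flip hc hX hu hx hy hyt).1 hyL hL
      · simp only [ε, decide_eq_true_eq]
        exact ⟨x, hx, rfl, hL⟩
    · simp only [hL, if_false]
      cases b
      · simp only [ε, Bool.not_false, decide_eq_true_eq]
        obtain ⟨y, hy, hyt⟩ := partner hX hx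
        exact ⟨y, hy, hyt, (LL_flip hc hX hu hx hy hyt).2 hL⟩
      · simp only [ε, Bool.not_true, decide_eq_false_iff_not]
        rintro ⟨y, hy, hyt, hyL⟩
        exact hL ((LL_same hc hX hu hx hy hyt.symm).2 hyL)
  have hlt : ∀ b, ∀ x ∈ DD F b, j (tt u x) < r := fun b x hx => h1 _ (hmem b x hx)
  have hpar : ∀ b, ∀ x ∈ DD F b, (if LL F u x then b else !b) = xor e0 (j (tt u x)).bodd := by
    intro b x hx
    rw [← hε b x hx]; exact h4 _ (hmem b x hx)
  refine ⟨r, fun x => if LL F u x then j (tt u x) else 2 * r - 1 - j (tt u x), ?_, ⟨e0, ?_⟩, ?_, ?_,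
    fun x => j (tt u x), ?_, ?_⟩
  · intro b x hx
    have := hlt b x hx
    split_ifs <;> omega
  · intro b x hx
    have a1 := hpar b x hx
    have a2 := hlt b x hx
    by_cases hL : LL F u x
    · simp only [hL, if_true] at a1 ⊢; exact a1
    · simp only [hL, if_false] at a1 ⊢
      have e : (2 * r - 1 - j (tt u x)) + j (tt u x) + 1 = 2 * r := by omega
      have e2 := congrArg Nat.bodd e
      simp only [Nat.bodd_succ, Nat.bodd_add, Nat.bodd_mul] at e2
      revert e2 a1
      cases (2 * r - 1 - j (tt u x)).bodd <;> cases (j (tt u x)).bodd <;> cases e0 <;> cases b <;> simp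
  · intro i hi
    have key : ∀ k < r, ∃ b, ∃ x ∈ DD F b, j (tt u x) = k := by
      intro k hk
      obtain ⟨t, ht, htk⟩ := h3 k hk
      obtain ⟨x, hx, rfl⟩ := Finset.mem_image.1 ht
      rcases Finset.mem_union.1 hx with hx | hx
      · exact ⟨_, x, hx, htk⟩
      · exact ⟨_, x, hx, htk⟩
    by_cases hir : i < r
    · obtain ⟨b, x, hx, hk⟩ := key i hir
      by_cases hL : LL F u x
      · exact ⟨b, x, hx, by simp [hL, hk]⟩
      · obtain ⟨y, hy, hyt⟩ := partner hX hx
        have := (LL_flip hc hX hu hx hy hyt).2 hL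
        exact ⟨_, y, hy, by simp [this, hk, hyt]⟩
    · obtain ⟨b, x, hx, hk⟩ := key (2 * r - 1 - i) (by omega)
      by_cases hL : LL F u x
      · obtain ⟨y, hy, hyt⟩ := partner hX hx
        have : ¬ LL F u y := fun h => (LL_flip hc hX hu hx hy hyt).1 h hL
        exact ⟨_, y, hy, by simp only [this, hk, hyt, if_false]; omega⟩
      · exact ⟨b, x, hx, by simp only [hL, hk, if_false]; omega⟩
  · intro b x hx w hw
    have px := hpar b x hx
    have pw := hpar _ w hw
    have lx := hlt b x hx
    have lw := hlt _ w hw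
    have m1 := h2 _ (hmem _ x hx) _ (hmem _ w hw)
    have m2 := h2 _ (hmem _ w hw) _ (hmem _ x hx)
    have hne : (LL F u x ↔ LL F u w) → j (tt u x) ≠ j (tt u w) := by
      intro hi he
      rw [he, ← pw] at px
      by_cases hL : LL F u x
      · have hL' := hi.1 hL
        simp [hL, hL'] at px
      · have hL' : ¬ LL F u w := fun h => hL (hi.2 h)
        simp [hL, hL'] at px
    simp only [BB, bf]
    by_cases hLx : LL F u x <;> by_cases hLw : LL F u w
    · have := hne (by tauto)
      simp only [hLx, hLw]
      simp
      constructor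
      · intro h; have := m1 h.le; omega
      · intro h; by_contra hcon; push Not at hcon; have := m2 hcon; omega
    · simp only [hLx, hLw]
      simp
      omega
    · simp only [hLx, hLw]
      simp
      omega
    · have := hne (by tauto)
      simp only [hLx, hLw]
      simp
      constructor
      · intro h; have := m2 h.le; omega
      · intro h; by_contra hcon; push Not at hcon; have := m1 hcon; omega
  · intro b x hx
    refine ⟨hlt b x hx, ?_⟩
    have := hlt b x hx
    by_cases hL : LL F u x
    · left; simp [hL]
    · right; simp only [hL, if_false]; omega
  · intro b x hx b' y hy h
    exact h2 _ (hmem _ x hx) _ (hmem _ y hy) h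

/-- cyclic order of arcs -/
lemma XX_num (hc : Cfg F K) (hX : XR F u) (hu : u ≠ 0) {r : ℕ} {P : ℝ × ℝ → ℕ} (hn : ArcNum F u r P)
    {b : Bool} {x y w z : ℝ × ℝ} (hx : x ∈ DD F b)
    (hy : y ∈ DD F b) (hw : w ∈ DD F (!b)) (hz : z ∈ DD F (!b)) :
    XX x w y z ↔ cyc (fun p q => P p < P q) x w y z := by
  have hx' : x ∈ DD F (!!b) := by rwa [Bool.not_not]
  have hy' : y ∈ DD F (!!b) := by rwa [Bool.not_not]
  rw [XX_iff hc hX hu hx hy hw hz]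
  simp only [cyc]
  rw [hn.ord b x hx w hw, hn.ord b y hy z hz, hn.ord _ w hw y hy', hn.ord _ z hz x hx']

lemma XX_reflect (hc : Cfg F K) (hX : XR F u) (hu : u ≠ 0)
    {b : Bool} {x y w z x' y' w' z' : ℝ × ℝ} (hx : x ∈ DD F b)
    (hy : y ∈ DD F b) (hw : w ∈ DD F (!b)) (hz : z ∈ DD F (!b))
    (hx' : x' ∈ DD F (!b)) (hy' : y' ∈ DD F (!b)) (hw' : w' ∈ DD F b) (hz' : z' ∈ DD F b)
    (ex : tt u x' = tt u x) (ey : tt u y' = tt u y) (ew : tt u w' = tt u w) (ez : tt u z' = tt u z) :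
    XX x w y z ↔ XX z' y' w' x' := by
  rw [XX_iff hc hX hu hx hy hw hz, XX_iff hc hX hu hz' hw' hy' hx']
  have hw2 : w' ∈ DD F (!!b) := by rwa [Bool.not_not]
  have hz2 : z' ∈ DD F (!!b) := by rwa [Bool.not_not]
  have lx := propext (LL_flip hc hX hu hx hx' ex)
  have ly := propext (LL_flip hc hX hu hy hy' ey)
  have lw := propext (LL_flip hc hX hu hw hw2 ew)
  have lz := propext (LL_flip hc hX hu hz hz2 ez)
  have e1 : cyc (BB F u) x w y z ↔ cyc bf (LL F u x, tt u x) (LL F u w, tt u w) (LL F u y, tt u y)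
    (LL F u z, tt u z) := Iff.rfl
  have e2 : cyc (BB F u) z' y' w' x' ↔ cyc bf (LL F u z', tt u z') (LL F u y', tt u y')
    (LL F u w', tt u w') (LL F u x', tt u x') := Iff.rfl
  rw [e1, e2, lx, ly, lw, lz, ex, ey, ew, ez]
  exact cyc_rev _ _ _ _ _ _ _ _

/-- cyclic successor -/
def scc (m p q : ℕ) : Prop := q = p + 1 ∨ (q = 0 ∧ p + 1 = m)

lemma scc_iff (hc : Cfg F K) (hX : XR F u) (hu : u ≠ 0) {r : ℕ} {P : ℝ × ℝ → ℕ} (hn : ArcNum F u r P)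
    {b : Bool} {x w : ℝ × ℝ} (hx : x ∈ DD F b) (hw : w ∈ DD F (!b)) :
    scc (2 * r) (P x) (P w) ↔ ¬ ∃ z ∈ DD F (!b), ∃ y ∈ DD F b, XX x z y w := by
  obtain ⟨e0, he0⟩ := hn.par
  have lx := hn.lt _ x hx
  have lw := hn.lt _ w hw
  constructor
  · rintro hs ⟨z, hz, y, hy, h⟩
    rw [XX_num hc hX hu hn hx hy hz hw] at h
    have lz := hn.lt _ z hz
    have ly := hn.lt _ y hy
    simp only [cyc] at h
    simp only [scc] at hs
    omega
  · intro h
    by_contra hs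
    apply h
    have hcol : ∀ p, ∀ y b', y ∈ DD F b' → (P y).bodd = p → b' = xor e0 p := by
      intro p y b' hy hp; rw [← hp]; exact he0 b' y hy
    have cx := he0 b x hx
    have cw := he0 _ w hw
    have hpar : (P x).bodd ≠ (P w).bodd := by
      intro he; rw [he] at cx; rw [← cx] at cw; revert cw; cases b <;> simp
    -- next two positions
    obtain ⟨p1, hp1, hp1', hb1⟩ : ∃ p1 < 2 * r, scc (2 * r) (P x) p1 ∧ p1.bodd = !(P x).bodd := by
      by_cases hh : P x + 1 < 2 * r
      · exact ⟨P x + 1, hh, Or.inl rfl, by simp⟩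
      · refine ⟨0, by omega, Or.inr ⟨rfl, by omega⟩, ?_⟩
        have e : P x + 1 = 2 * r := by omega
        have := congrArg Nat.bodd e
        simp at this
        simp [this]
    obtain ⟨p2, hp2, hp2', hb2⟩ : ∃ p2 < 2 * r, scc (2 * r) p1 p2 ∧ p2.bodd = (P x).bodd := by
      by_cases hh : p1 + 1 < 2 * r
      · exact ⟨p1 + 1, hh, Or.inl rfl, by simp [hb1]⟩
      · refine ⟨0, by omega, Or.inr ⟨rfl, by omega⟩, ?_⟩
        have e : p1 + 1 = 2 * r := by omega
        have := congrArg Nat.bodd e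
        simp [hb1] at this
        simp [this]
    obtain ⟨b1, z, hz, hzp⟩ := hn.surj p1 hp1
    obtain ⟨b2, y, hy, hyp⟩ := hn.surj p2 hp2
    have hb1' : b1 = !b := by
      have := he0 b1 z hz
      rw [hzp, hb1] at this; rw [this, cx]; cases e0 <;> cases (P x).bodd <;> rfl
    have hb2' : b2 = b := by
      have := he0 b2 y hy
      rw [hyp, hb2] at this; rw [this, ← cx]
    subst hb1' hb2'
    refine ⟨z, hz, y, hy, ?_⟩
    rw [XX_num hc hX hu hn hx hy hz hw]
    have n1 : P w ≠ P x := fun h => hpar (by rw [h])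
    have n2 : P w ≠ p2 := fun h => hpar (by rw [h, hb2])
    simp only [cyc, hzp, hyp]
    simp only [scc] at hs hp1' hp2'
    omega

lemma scc_reflect (hc : Cfg F K) (hX : XR F u) (hu : u ≠ 0) {r : ℕ} {P : ℝ × ℝ → ℕ} (hn : ArcNum F u r P)
    {v : ℝ × ℝ} (hXv : XR F v) (hv : v ≠ 0)
    {b : Bool} {x w x' w' : ℝ × ℝ} (hx : x ∈ DD F b) (hw : w ∈ DD F (!b))
    (hx' : x' ∈ DD F (!b)) (hw' : w' ∈ DD F b)
    (ex : tt v x' = tt v x) (ew : tt v w' = tt v w)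
    (h : scc (2 * r) (P x) (P w)) : scc (2 * r) (P w') (P x') := by
  rw [scc_iff hc hX hu hn hw' hx']
  rintro ⟨z, hz, y, hy, hXX⟩
  rw [scc_iff hc hX hu hn hx hw] at h
  apply h
  obtain ⟨y', hy', ey⟩ := partner hXv hy
  obtain ⟨z', hz', ez⟩ := partner hXv hz
  rw [Bool.not_not] at hz'
  refine ⟨y', hy', z', hz', ?_⟩
  exact (XX_reflect hc hXv hv hw' hy hz hx' hw hy' hz' hx ew.symm ey ez ex.symm).1 hXX

/-- the reflection acts on arc numbers as `i ↦ c - i` -/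
lemma exists_c (hc : Cfg F K) (hX : XR F u) (hu : u ≠ 0) {r : ℕ} {P : ℝ × ℝ → ℕ} (hn : ArcNum F u r P)
    {v : ℝ × ℝ} (hXv : XR F v) (hv : v ≠ 0) :
    ∃ c : ℕ, ∀ b, ∀ x ∈ DD F b, ∀ x' ∈ DD F (!b), tt v x' = tt v x → (P x + P x') % (2 * r) = c := by
  by_cases hr : r = 0
  · refine ⟨0, fun b x hx => ?_⟩
    have := hn.lt b x hx
    omega
  obtain ⟨e0, he0⟩ := hn.par
  have claimA : ∀ b, ∀ x ∈ DD F b, ∀ x' ∈ DD F (!b), ∀ b', ∀ w ∈ DD F b', ∀ w' ∈ DD F (!b'),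
      tt v x' = tt v x → tt v w' = tt v w → P w = P x + 1 →
      (P x + P x') % (2 * r) = (P w + P w') % (2 * r) := by
    intro b x hx x' hx' b' w hw w' hw' ex ew hP
    have hb : b' = !b := by
      have h1 := he0 b x hx
      have h2 := he0 b' w hw
      rw [hP, Nat.bodd_succ] at h2
      rw [h2, h1]; cases e0 <;> cases (P x).bodd <;> rfl
    subst hb
    rw [Bool.not_not] at hw'
    have := scc_reflect hc hX hu hn hXv hv hx hw hx' hw' ex ew (Or.inl hP)
    have lx' := hn.lt _ x' hx'
    rcases this with h | ⟨h, h'⟩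
    · congr 1; omega
    · have : P w + P w' = P x + P x' + 2 * r := by omega
      rw [this, Nat.add_mod_right]
  have hrep : ∀ i, ∃ b, ∃ x ∈ DD F b, ∃ x' ∈ DD F (!b), tt v x' = tt v x ∧ (i < 2 * r → P x = i) := by
    intro i
    by_cases hi : i < 2 * r
    · obtain ⟨b, x, hx, h⟩ := hn.surj i hi
      obtain ⟨x', hx', e⟩ := partner hXv hx
      exact ⟨b, x, hx, x', hx', e, fun _ => h⟩
    · obtain ⟨b, x, hx, h⟩ := hn.surj 0 (by omega)
      obtain ⟨x', hx', e⟩ := partner hXv hx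
      exact ⟨b, x, hx, x', hx', e, fun h => absurd h hi⟩
  choose bb X hXm X' hX'm hXe hXP using hrep
  have hall : ∀ i < 2 * r, (P (X i) + P (X' i)) % (2 * r) = (P (X 0) + P (X' 0)) % (2 * r) := by
    intro i
    induction i with
    | zero => intro _; rfl
    | succ i ih =>
      intro hi
      rw [← ih (by omega)]
      exact (claimA _ _ (hXm i) _ (hX'm i) _ _ (hXm (i + 1)) _ (hX'm (i + 1)) (hXe i) (hXe (i + 1))
        (by rw [hXP _ hi, hXP i (by omega)])).symm
  refine ⟨(P (X 0) + P (X' 0)) % (2 * r), ?_⟩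
  intro b x hx x' hx' e
  have lx := hn.lt _ x hx
  by_cases h : P x + 1 < 2 * r
  · rw [← hall _ h]
    exact claimA _ _ hx _ hx' _ _ (hXm _) _ (hX'm _) e (hXe _) (hXP _ h)
  · rw [← hall (P x - 1) (by omega)]
    exact (claimA _ _ (hXm _) _ (hX'm _) _ _ hx _ hx' (hXe _) e (by rw [hXP _ (by omega)]; omega)).symm

end
set_option linter.unusedVariables false

lemma alg_part (m : ℕ) (hm : 0 < m) (z : Fin 7 → ℂ) (hz : Function.Injective z) (hzm : ∀ i, z i ^ m = 1)
    (u : Fin 7 → ℤ × ℤ) (hu : ∀ i j, i ≠ j → (u i).1 * (u j).2 - (u i).2 * (u j).1 ≠ 0)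
    (A1 A2 B1 B2 : ℂ) (hA : ¬ (A1 = 0 ∧ A2 = 0))
    (h : ∀ i, ((u i).1 : ℂ) * A2 - (u i).2 * A1 = z i * ((u i).1 * B2 - (u i).2 * B1)) : False := by
  have huC : ∀ i j, i ≠ j → ((u i).1 : ℂ) * (u j).2 - (u i).2 * (u j).1 ≠ 0 := by
    intro i j hij
    exact_mod_cast hu i j hij
  have two : ∀ i j, i ≠ j → ((u i).1 : ℂ) * A2 - (u i).2 * A1 = 0 →
      ((u j).1 : ℂ) * A2 - (u j).2 * A1 = 0 → False := by
    intro i j hij h1 h2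
    apply hA
    have d := huC i j hij
    constructor
    · have : (((u i).1 : ℂ) * (u j).2 - (u i).2 * (u j).1) * A1 = 0 := by
        linear_combination (u j).1 * h1 - (u i).1 * h2
      exact (mul_eq_zero.1 this).resolve_left d
    · have : (((u i).1 : ℂ) * (u j).2 - (u i).2 * (u j).1) * A2 = 0 := by
        linear_combination (u j).2 * h1 - (u i).2 * h2
      exact (mul_eq_zero.1 this).resolve_left d
  have hΔ : A1 * B2 - A2 * B1 ≠ 0 := by
    intro hΔ
    obtain ⟨l, hl1, hl2⟩ : ∃ l : ℂ, B1 = l * A1 ∧ B2 = l * A2 := by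
      by_cases h1 : A1 = 0
      · have h2 : A2 ≠ 0 := fun h2 => hA ⟨h1, h2⟩
        refine ⟨B2 / A2, ?_, by field_simp⟩
        rw [h1] at hΔ ⊢
        have : A2 * B1 = 0 := by linear_combination -hΔ
        simp [(mul_eq_zero.1 this).resolve_left h2]
      · refine ⟨B1 / A1, by field_simp, ?_⟩
        field_simp
        linear_combination hΔ
    have key : ∀ i, ((u i).1 : ℂ) * A2 - (u i).2 * A1 = 0 ∨ z i * l = 1 := by
      intro i
      have := h i
      rw [hl1, hl2] at this
      have h2 : (((u i).1 : ℂ) * A2 - (u i).2 * A1) * (1 - z i * l) = 0 := by linear_combination this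
      rcases mul_eq_zero.1 h2 with h3 | h3
      · exact Or.inl h3
      · right; linear_combination -h3
    have ne : ∀ i j, i ≠ j → z i * l = 1 → z j * l = 1 → False := by
      intro i j hij h1 h2
      apply hij
      apply hz
      have hl0 : l ≠ 0 := by rintro rfl; simp at h1
      exact mul_right_cancel₀ hl0 (h1.trans h2.symm)
    rcases key 0 with h0 | h0 <;> rcases key 1 with h1 | h1 <;> rcases key 2 with h2 | h2
    · exact two 0 1 (by decide) h0 h1
    · exact two 0 1 (by decide) h0 h1
    · exact two 0 2 (by decide) h0 h2
    · exact ne 1 2 (by decide) h1 h2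
    · exact two 1 2 (by decide) h1 h2
    · exact ne 0 2 (by decide) h0 h2
    · exact ne 0 1 (by decide) h0 h1
    · exact ne 0 1 (by decide) h0 h1
  have hk : ∀ i, ∃ κ : ℂ, ((u i).1 : ℂ) = κ * (A1 - z i * B1) ∧ ((u i).2 : ℂ) = κ * (A2 - z i * B2) := by
    intro i
    have hi := h i
    by_cases h1 : A1 - z i * B1 = 0
    · have h2 : A2 - z i * B2 ≠ 0 := by
        intro h2
        apply hΔ
        linear_combination h1 * B2 - h2 * B1
      refine ⟨(u i).2 / (A2 - z i * B2), ?_, by field_simp⟩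
      have : ((u i).1 : ℂ) * (A2 - z i * B2) = 0 := by linear_combination hi + (u i).2 * h1
      rw [h1, (mul_eq_zero.1 this).resolve_right h2]; simp
    · refine ⟨(u i).1 / (A1 - z i * B1), by field_simp, ?_⟩
      field_simp
      linear_combination -hi
  choose κ k1 k2 using hk
  have hD : ∀ i j, (((u i).1 * (u j).2 - (u i).2 * (u j).1 : ℤ) : ℂ)
      = κ i * κ j * (z i - z j) * (A1 * B2 - A2 * B1) := by
    intro i j
    push_cast
    rw [k1, k2, k1, k2]
    ring
  apply nt_main m hm z hz hzm (fun i j => (u i).1 * (u j).2 - (u i).2 * (u j).1) (fun i j hij => hu i j hij)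
  intro i j k l
  rw [hD i j, hD k l, hD i k, hD j l]
  ring

/-- sum over all difference points -/
noncomputable def SD (F : Bool → Finset (ℝ × ℝ)) (g : ℝ × ℝ → ℂ) : ℂ := ∑ b : Bool, ∑ x ∈ DD F b, g x

section
variable {F : Bool → Finset (ℝ × ℝ)} {K : Bool → Set (ℝ × ℝ)} {u : ℝ × ℝ}

lemma exists_bijOn_fin {α : Type*} (s t : Finset α) (h : s.card = t.card) :
    ∃ g : α → α, BijOn g s t := by
  classical
  let E := Finset.equivOfCardEq h
  refine ⟨fun x => if hx : x ∈ s then (E ⟨x, hx⟩ : α) else x, ?_, ?_, ?_⟩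
  · intro x hx
    have hx' : x ∈ s := hx
    simp [hx']
  · intro x hx y hy hxy
    have hx' : x ∈ s := hx
    have hy' : y ∈ s := hy
    simp only [hx', hy', dif_pos] at hxy
    have := E.injective (Subtype.ext hxy)
    exact congrArg Subtype.val this
  · intro y hy
    refine ⟨E.symm ⟨y, hy⟩, (E.symm ⟨y, hy⟩).2, ?_⟩
    simp

lemma exists_bij (hX : XR F u) (b : Bool) : ∃ e : ℝ × ℝ → ℝ × ℝ,
    BijOn e (DD F b) (DD F (!b)) ∧ ∀ x ∈ DD F b, tt u (e x) = tt u x := by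
  classical
  choose g hg using fun c : ℝ => exists_bijOn_fin _ _ (XR_DD hX b c)
  have h1 : ∀ x ∈ DD F b, g (tt u x) x ∈ DD F (!b) ∧ tt u (g (tt u x) x) = tt u x := by
    intro x hx
    have := (hg (tt u x)).mapsTo (x := x) (by simp [hx])
    simpa using this
  refine ⟨fun x => g (tt u x) x, ⟨fun x hx => (h1 x hx).1, ?_, ?_⟩, fun x hx => (h1 x hx).2⟩
  · intro x hx y hy hxy
    have e : tt u x = tt u y := by
      rw [← (h1 x hx).2, ← (h1 y hy).2]; exact congrArg _ hxy
    dsimp only at hxy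
    rw [← e] at hxy
    have hx' : x ∈ DD F b := hx
    have hy' : y ∈ DD F b := hy
    exact (hg (tt u x)).injOn (by simp [hx']) (by simp [hy', e]) hxy
  · intro y hy
    have hy' : y ∈ DD F (!b) := hy
    obtain ⟨x, hx, hxy⟩ := (hg (tt u y)).surjOn (a := y) (by simp [hy'])
    have hx' : x ∈ DD F b ∧ tt u x = tt u y := by simpa using hx
    refine ⟨x, hx'.1, ?_⟩
    dsimp only
    rw [hx'.2]; exact hxy

lemma SD_reflect (hX : XR F u) {r : ℕ} {P : ℝ × ℝ → ℕ} {c : ℕ}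
    (hc : ∀ b, ∀ x ∈ DD F b, ∀ x' ∈ DD F (!b), tt u x' = tt u x → (P x + P x') % (2 * r) = c)
    (ω : ℂ) (hω : ω ^ (2 * r) = 1) (hω0 : ω ≠ 0) (f : ℝ → ℂ) :
    SD F (fun x => f (tt u x) * ω ^ P x) = ω ^ c * SD F (fun x => f (tt u x) * (ω ^ P x)⁻¹) := by
  have key : ∀ b, ∑ x ∈ DD F (!b), f (tt u x) * ω ^ P x = ω ^ c * ∑ x ∈ DD F b, f (tt u x) * (ω ^ P x)⁻¹ := by
    intro b
    obtain ⟨e, he, ht⟩ := exists_bij hX b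
    rw [Finset.mul_sum]
    symm
    apply Finset.sum_nbij e
    · intro x hx; exact he.mapsTo hx
    · exact he.injOn
    · exact he.surjOn
    · intro x hx
      rw [ht x hx]
      have h1 := hc b x hx (e x) (he.mapsTo hx) (ht x hx)
      have h2 : ω ^ c = ω ^ P x * ω ^ P (e x) := by
        rw [← pow_add, ← h1, ← pow_mod_orderOf ω (P x + P (e x)),
          ← pow_mod_orderOf ω ((P x + P (e x)) % (2 * r))]
        rw [Nat.mod_mod_of_dvd _ (orderOf_dvd_of_pow_eq_one hω)]
      rw [h2]
      have : ω ^ P x ≠ 0 := pow_ne_zero _ hω0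
      field_simp
  simp only [SD, Fintype.sum_bool]
  have h1 := key true
  have h2 := key false
  simp only [Bool.not_true, Bool.not_false] at h1 h2
  rw [h1, h2]; ring

/-- points in one arc lie on the same side for every direction -/
lemma same_side (hc : Cfg F K) (hX : XR F u) (hu : u ≠ 0) {r : ℕ} {P : ℝ × ℝ → ℕ} (hn : ArcNum F u r P)
    {v : ℝ × ℝ} (hXv : XR F v) (hv : v ≠ 0) {b : Bool} {x y : ℝ × ℝ} (hx : x ∈ DD F b)
    (hy : y ∈ DD F b) (hP : P x = P y) (hLx : LL F v x) : LL F v y := by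
  by_contra hLy
  obtain ⟨x', hx', ex⟩ := partner hXv hx
  obtain ⟨y', hy', ey⟩ := partner hXv hy
  have lx' : ¬ LL F v x' := fun h => (LL_flip hc hXv hv hx hx' ex).1 h hLx
  have ly' : LL F v y' := (LL_flip hc hXv hv hy hy' ey).2 hLy
  rcases lt_trichotomy (tt v x) (tt v y) with h | h | h
  · have h1 : XX x y' y x' := by
      rw [XX_iff hc hXv hv hx hy hy' hx']
      simp only [cyc, BB, bf, lx', ly', hLx, hLy, ex, ey]
      simp [h]
    rw [XX_num hc hX hu hn hx hy hy' hx'] at h1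
    simp only [cyc] at h1
    omega
  · exact hLy ((LL_same hc hXv hv hx hy h).1 hLx)
  · have h1 : XX x x' y y' := by
      rw [XX_iff hc hXv hv hx hy hx' hy']
      simp only [cyc, BB, bf, lx', ly', hLx, hLy, ex, ey]
      simp [h]
    rw [XX_num hc hX hu hn hx hy hx' hy'] at h1
    simp only [cyc] at h1
    omega

lemma arc_shift (hc : Cfg F K) (hX : XR F u) (hu : u ≠ 0) {r : ℕ} {P : ℝ × ℝ → ℕ} (hn : ArcNum F u r P)
    {v : ℝ × ℝ} (hXv : XR F v) (hv : v ≠ 0) {c : ℕ}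
    (hcv : ∀ b, ∀ x ∈ DD F b, ∀ x' ∈ DD F (!b), tt v x' = tt v x → (P x + P x') % (2 * r) = c)
    (b : Bool) (i : ℕ) (hi : ∃ x ∈ DD F b, P x = i) :
    ∑ x ∈ (DD F (!b)).filter (fun x => (i + P x) % (2 * r) = c), tt v x
      = ∑ x ∈ (DD F b).filter (fun x => P x = i), tt v x ∧
    ∑ x ∈ (DD F (!b)).filter (fun x => (i + P x) % (2 * r) = c), ss v x
      ≠ ∑ x ∈ (DD F b).filter (fun x => P x = i), ss v x := by
  obtain ⟨e, he, ht⟩ := exists_bij hXv b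
  have m1 : ∀ x ∈ (DD F b).filter (fun x => P x = i),
      e x ∈ (DD F (!b)).filter (fun x => (i + P x) % (2 * r) = c) := by
    intro x hx
    obtain ⟨hx, hxi⟩ := Finset.mem_filter.1 hx
    refine Finset.mem_filter.2 ⟨he.mapsTo hx, ?_⟩
    rw [← hxi]
    exact hcv b x hx _ (he.mapsTo hx) (ht x hx)
  have m2 : InjOn e ((DD F b).filter (fun x => P x = i)) := by
    intro x hx y hy hxy
    exact he.injOn (Finset.mem_filter.1 hx).1 (Finset.mem_filter.1 hy).1 hxy
  have m3 : SurjOn e ((DD F b).filter (fun x => P x = i))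
      ((DD F (!b)).filter (fun x => (i + P x) % (2 * r) = c)) := by
    intro y hy
    obtain ⟨hy, hyc⟩ := Finset.mem_filter.1 hy
    obtain ⟨x, hx, rfl⟩ := he.surjOn hy
    refine ⟨x, Finset.mem_coe.2 (Finset.mem_filter.2 ⟨hx, ?_⟩), rfl⟩
    have h1 := hcv b x hx _ (he.mapsTo hx) (ht x hx)
    have h2 : P x + P (e x) ≡ i + P (e x) [MOD (2 * r)] := h1.trans hyc.symm
    have h3 := Nat.ModEq.add_right_cancel' _ h2
    obtain ⟨x0, hx0, hx0i⟩ := hi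
    have l1 := hn.lt _ _ hx
    have l2 := hn.lt _ _ hx0
    rw [← hx0i] at h3 ⊢
    exact Nat.ModEq.eq_of_lt_of_lt h3 l1 l2
  have s1 : ∀ f : ℝ × ℝ → ℝ, ∑ x ∈ (DD F (!b)).filter (fun x => (i + P x) % (2 * r) = c), f x
      = ∑ x ∈ (DD F b).filter (fun x => P x = i), f (e x) := by
    intro f
    symm
    exact Finset.sum_nbij e m1 m2 m3 (fun _ _ => rfl)
  rw [s1, s1]
  constructor
  · apply Finset.sum_congr rfl
    intro x hx
    exact ht x (Finset.mem_filter.1 hx).1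
  · obtain ⟨x0, hx0, hx0i⟩ := hi
    by_cases hL : LL F v x0
    · apply ne_of_gt
      apply Finset.sum_lt_sum_of_nonempty ⟨x0, Finset.mem_filter.2 ⟨hx0, hx0i⟩⟩
      intro x hx
      obtain ⟨hx, hxi⟩ := Finset.mem_filter.1 hx
      have := same_side hc hX hu hn hXv hv hx0 hx (hx0i.trans hxi.symm) hL
      exact LL_spec hc hv hx this (DD_K hc (he.mapsTo hx)) (ht x hx)
    · apply ne_of_lt
      apply Finset.sum_lt_sum_of_nonempty ⟨x0, Finset.mem_filter.2 ⟨hx0, hx0i⟩⟩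
      intro x hx
      obtain ⟨hx, hxi⟩ := Finset.mem_filter.1 hx
      have : ¬ LL F v x := fun h => hL (same_side hc hX hu hn hXv hv hx hx0 (hxi.trans hx0i.symm) h)
      exact nLL_spec hc hXv hv hx this (DD_K hc (he.mapsTo hx)) (ht x hx)

lemma c_ne (hc : Cfg F K) (hX : XR F u) (hu : u ≠ 0) {r : ℕ} {P : ℝ × ℝ → ℕ} (hn : ArcNum F u r P)
    {v v' : ℝ × ℝ} (hXv : XR F v) (hXv' : XR F v') (hd : v.1 * v'.2 - v.2 * v'.1 ≠ 0) {c : ℕ}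
    (hcv : ∀ b, ∀ x ∈ DD F b, ∀ x' ∈ DD F (!b), tt v x' = tt v x → (P x + P x') % (2 * r) = c)
    (hcv' : ∀ b, ∀ x ∈ DD F b, ∀ x' ∈ DD F (!b), tt v' x' = tt v' x → (P x + P x') % (2 * r) = c)
    {b : Bool} {x : ℝ × ℝ} (hx : x ∈ DD F b) : False := by
  have hv : v ≠ 0 := by rintro rfl; simp at hd
  have hv' : v' ≠ 0 := by rintro rfl; simp at hd
  obtain ⟨a1, a2⟩ := arc_shift hc hX hu hn hXv hv hcv b (P x) ⟨x, hx, rfl⟩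
  obtain ⟨a3, a4⟩ := arc_shift hc hX hu hn hXv' hv' hcv' b (P x) ⟨x, hx, rfl⟩
  simp only [tt, ss, Finset.sum_add_distrib, Finset.sum_sub_distrib, ← Finset.mul_sum] at a1 a2 a3
  generalize (∑ y ∈ (DD F (!b)).filter (fun y => (P x + P y) % (2 * r) = c), y.1) = p1 at *
  generalize (∑ y ∈ (DD F (!b)).filter (fun y => (P x + P y) % (2 * r) = c), y.2) = p2 at *
  generalize (∑ y ∈ (DD F b).filter (fun y => P y = P x), y.1) = q1 at *
  generalize (∑ y ∈ (DD F b).filter (fun y => P y = P x), y.2) = q2 at *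
  apply a2
  have e1 : (v.1 * v'.2 - v.2 * v'.1) * (p1 - q1) = 0 := by linear_combination v'.1 * a1 - v.1 * a3
  have e2 : (v.1 * v'.2 - v.2 * v'.1) * (p2 - q2) = 0 := by linear_combination v'.2 * a1 - v.2 * a3
  have f1 := (mul_eq_zero.1 e1).resolve_left hd
  have f2 := (mul_eq_zero.1 e2).resolve_left hd
  linear_combination v.1 * f1 + v.2 * f2

end
set_option linter.unusedVariables false

lemma cheb {α : Type*} (D : Finset α) (t g : α → ℝ)
    (h1 : ∀ x ∈ D, ∀ y ∈ D, t x ≤ t y → g y ≤ g x)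
    (h2 : ∃ x ∈ D, ∃ y ∈ D, t x < t y ∧ g y < g x)
    (h3 : ∑ x ∈ D, g x = 0) (h4 : ∑ x ∈ D, t x * g x = 0) : False := by
  have hle : ∀ x ∈ D, ∀ y ∈ D, (t x - t y) * (g x - g y) ≤ 0 := by
    intro x hx y hy
    rcases le_total (t x) (t y) with h | h
    · have := h1 x hx y hy h
      nlinarith
    · have := h1 y hy x hx h
      nlinarith
  have hneg : ∑ x ∈ D, ∑ y ∈ D, (t x - t y) * (g x - g y) < 0 := by
    obtain ⟨x, hx, y, hy, a, b⟩ := h2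
    apply Finset.sum_neg' (fun i hi => Finset.sum_nonpos (hle i hi))
    refine ⟨x, hx, ?_⟩
    apply Finset.sum_neg' (hle x hx)
    exact ⟨y, hy, by nlinarith⟩
  have hz : ∑ x ∈ D, ∑ y ∈ D, (t x - t y) * (g x - g y) = 0 := by
    have : ∀ x y, (t x - t y) * (g x - g y) = t x * g x - t x * g y - t y * g x + t y * g y := by
      intros; ring
    simp only [this, Finset.sum_add_distrib, Finset.sum_sub_distrib, ← Finset.mul_sum, ← Finset.sum_mul,
      h3, h4, Finset.sum_const]
    have e : ∀ x, t x * ((D.card : ℝ) * g x) = D.card * (t x * g x) := by intro x; ring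
    simp [e, ← Finset.mul_sum, h4]
  linarith

section
variable {F : Bool → Finset (ℝ × ℝ)} {K : Bool → Set (ℝ × ℝ)} {u : ℝ × ℝ}

lemma A_ne {r : ℕ} (hr : 2 ≤ r) {P : ℝ × ℝ → ℕ} (hn : ArcNum F u r P) (ω : ℂ)
    (hω : ω = Complex.exp (2 * Real.pi * Complex.I / ((2 * r : ℕ) : ℂ)))
    (hS : SD F (fun x => ω ^ P x) = 0)
    (hA : SD F (fun x => (tt u x : ℂ) * ω ^ P x) = 0) : False := by
  classical
  obtain ⟨J, hJ1, hJ2⟩ := hn.mono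
  have hr0 : (r : ℝ) ≠ 0 := by positivity
  have hr0C : (r : ℂ) ≠ 0 := by exact_mod_cast hr0
  let g : ℝ × ℝ → ℝ := fun x => Real.cos (Real.pi * (J x + 1 / 2) / r)
  have hre : ∀ b, ∀ x ∈ DD F b, (ω ^ P x * Complex.exp (Real.pi * Complex.I / ((2 * r : ℕ) : ℂ))).re = g x := by
    intro b x hx
    have e1 : ω ^ P x * Complex.exp (Real.pi * Complex.I / ((2 * r : ℕ) : ℂ))
        = Complex.exp (((Real.pi * (P x + 1 / 2) / r : ℝ) : ℂ) * Complex.I) := by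
      rw [hω, ← Complex.exp_nat_mul, ← Complex.exp_add]
      congr 1
      push_cast
      field_simp
    rw [e1, Complex.exp_ofReal_mul_I_re]
    obtain ⟨hlt, h | h⟩ := hJ1 b x hx
    · simp only [g, h]
    · have hP : (P x : ℝ) = 2 * r - 1 - J x := by
        have : (P x : ℝ) + J x + 1 = 2 * r := by exact_mod_cast h
        linarith
      simp only [g]
      rw [hP]
      have : Real.pi * (2 * r - 1 - J x + 1 / 2) / r = 2 * Real.pi - Real.pi * (J x + 1 / 2) / r := by
        field_simp; ring
      rw [this, Real.cos_two_pi_sub]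
  have hmem : ∀ x ∈ DD F true ∪ DD F false, ∃ b, x ∈ DD F b := by
    intro x hx
    rcases Finset.mem_union.1 hx with h | h
    · exact ⟨_, h⟩
    · exact ⟨_, h⟩
  have hmem' : ∀ b, ∀ x ∈ DD F b, x ∈ DD F true ∪ DD F false := by
    intro b x hx; cases b <;> simp [hx]
  have hdis : Disjoint (DD F true) (DD F false) := by
    rw [Finset.disjoint_left]
    intro x h1 h2
    exact Bool.noConfusion (DD_color h1 h2)
  have hsum : ∀ f : ℝ × ℝ → ℝ, SD F (fun x => (f x : ℂ) * ω ^ P x) = 0 →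
      ∑ x ∈ DD F true ∪ DD F false, f x * g x = 0 := by
    intro f hf
    have h1 : SD F (fun x => (f x : ℂ) * ω ^ P x)
        = ∑ x ∈ DD F true ∪ DD F false, (f x : ℂ) * ω ^ P x := by
      rw [Finset.sum_union hdis, SD, Fintype.sum_bool]
    rw [h1] at hf
    have h2 : ∑ x ∈ DD F true ∪ DD F false, (f x : ℂ) *
        (ω ^ P x * Complex.exp (Real.pi * Complex.I / ((2 * r : ℕ) : ℂ))) = 0 := by
      simp only [← mul_assoc]
      rw [← Finset.sum_mul, hf, zero_mul]
    have h3 := congrArg Complex.re h2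
    rw [Complex.re_sum] at h3
    rw [← Complex.zero_re, ← h3]
    apply Finset.sum_congr rfl
    intro x hx
    obtain ⟨b, hb⟩ := hmem x hx
    rw [Complex.re_ofReal_mul, hre b x hb]
  have hanti : ∀ b, ∀ x ∈ DD F b, ∀ b', ∀ y ∈ DD F b', J x < J y → g y < g x := by
    intro b x hx b' y hy h
    have hr' : (0 : ℝ) < r := by positivity
    have hy1 : (J y : ℝ) + 1 ≤ r := by exact_mod_cast (hJ1 b' y hy).1
    have hxy : (J x : ℝ) < J y := by exact_mod_cast h
    have hpi := Real.pi_pos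
    apply Real.strictAntiOn_cos
    · constructor
      · positivity
      · rw [div_le_iff₀ hr']; nlinarith
    · constructor
      · positivity
      · rw [div_le_iff₀ hr']; nlinarith
    · gcongr
  apply cheb (DD F true ∪ DD F false) (tt u) g
  · intro x hx y hy h
    obtain ⟨b, hb⟩ := hmem x hx
    obtain ⟨b', hb'⟩ := hmem y hy
    have := hJ2 b x hb b' y hb' h
    rcases this.eq_or_lt with h' | h'
    · simp only [g, h']; exact le_refl _
    · exact (hanti b x hb b' y hb' h').le
  · obtain ⟨b, x, hx, hPx⟩ := hn.surj 0 (by omega)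
    obtain ⟨b', y, hy, hPy⟩ := hn.surj (r - 1) (by omega)
    have jx := hJ1 b x hx
    have jy := hJ1 b' y hy
    have hlt : J x < J y := by omega
    refine ⟨x, hmem' b x hx, y, hmem' b' y hy, ?_, hanti b x hx b' y hy hlt⟩
    by_contra hcon
    push Not at hcon
    have := hJ2 b' y hy b x hx hcon
    omega
  · have := hsum (fun _ => 1) (by simpa using hS)
    simpa using this
  · exact hsum (tt u) hA

end

theorem planar {F : Bool → Finset (ℝ × ℝ)} {K : Bool → Set (ℝ × ℝ)} (hc : Cfg F K)
    (u : Fin 7 → ℤ × ℤ) (hu : ∀ i j, i ≠ j → (u i).1 * (u j).2 - (u i).2 * (u j).1 ≠ 0)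
    (hX : ∀ i, XR F (((u i).1 : ℝ), ((u i).2 : ℝ))) {b : Bool} {x : ℝ × ℝ} (hx : x ∈ DD F b) : False := by
  set v : Fin 7 → ℝ × ℝ := fun i => (((u i).1 : ℝ), ((u i).2 : ℝ)) with hv
  have hdet : ∀ i j, i ≠ j → (v i).1 * (v j).2 - (v i).2 * (v j).1 ≠ 0 := by
    intro i j hij
    simp only [hv]
    exact_mod_cast hu i j hij
  have hv0 : ∀ i, v i ≠ 0 := by
    intro i h0
    obtain ⟨j, hj⟩ := exists_ne i
    apply hdet i j hj.symm
    simp [h0]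
  obtain ⟨r, P, hn⟩ := exists_num hc (hX 0) (hv0 0)
  choose c hcc using fun i => exists_c hc (hX 0) (hv0 0) hn (hX i) (hv0 i)
  have hcinj : Function.Injective c := by
    intro i j hij
    by_contra hne
    refine c_ne hc (hX 0) (hv0 0) hn (hX i) (hX j) (hdet i j hne) (hcc i) ?_ hx
    rw [hij]; exact hcc j
  have hlt0 := hn.lt _ _ hx
  have hclt : ∀ i, c i < 2 * r := by
    intro i
    obtain ⟨x', hx', e⟩ := partner (hX i) hx
    rw [← hcc i b x hx x' hx' e]
    exact Nat.mod_lt _ (by omega)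
  have hr : 2 ≤ r := by
    have := Fintype.card_le_of_injective (fun i => (⟨c i, hclt i⟩ : Fin (2 * r)))
      (fun i j h => hcinj (by simpa using h))
    simp at this
    omega
  set ω : ℂ := Complex.exp (2 * Real.pi * Complex.I / ((2 * r : ℕ) : ℂ)) with hω
  have hprim : IsPrimitiveRoot ω (2 * r) := Complex.isPrimitiveRoot_exp (2 * r) (by omega)
  have hω1 := hprim.pow_eq_one
  have hω0 : ω ≠ 0 := Complex.exp_ne_zero _
  have hzinj : Function.Injective (fun i => ω ^ c i) := by
    intro i j h
    exact hcinj (hprim.pow_inj (hclt i) (hclt j) h)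
  have hS : SD F (fun x => ω ^ P x) = 0 := by
    have a : ∀ i, SD F (fun x => ω ^ P x) = ω ^ c i * SD F (fun x => (ω ^ P x)⁻¹) := by
      intro i
      simpa using SD_reflect (hX i) (hcc i) ω hω1 hω0 (fun _ => 1)
    have h2 : (ω ^ c 0 - ω ^ c 1) * SD F (fun x => (ω ^ P x)⁻¹) = 0 := by
      linear_combination a 1 - a 0
    have hne : ω ^ c 0 - ω ^ c 1 ≠ 0 := by
      rw [sub_ne_zero]
      intro h; exact absurd (hzinj h) (by decide)
    rw [a 0, (mul_eq_zero.1 h2).resolve_left hne, mul_zero]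
  have hlin : ∀ (w : ℝ × ℝ) (f : ℝ × ℝ → ℂ), SD F (fun x => (tt w x : ℂ) * f x)
      = w.1 * SD F (fun x => (x.2 : ℂ) * f x) - w.2 * SD F (fun x => (x.1 : ℂ) * f x) := by
    intro w f
    simp only [SD, Fintype.sum_bool, mul_add, Finset.mul_sum, tt]
    push_cast
    simp only [sub_mul, Finset.sum_sub_distrib, mul_assoc]
    ring
  refine alg_part (2 * r) (by omega) (fun i => ω ^ c i) hzinj ?_ u hu
    (SD F (fun x => (x.1 : ℂ) * ω ^ P x)) (SD F (fun x => (x.2 : ℂ) * ω ^ P x))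
    (SD F (fun x => (x.1 : ℂ) * (ω ^ P x)⁻¹)) (SD F (fun x => (x.2 : ℂ) * (ω ^ P x)⁻¹)) ?_ ?_
  · intro i
    rw [← pow_mul, mul_comm, pow_mul, hω1, one_pow]
  · rintro ⟨h1, h2⟩
    refine A_ne hr hn ω hω hS ?_
    rw [hlin, h1, h2]; simp
  · intro i
    have := SD_reflect (hX i) (hcc i) ω hω1 hω0 (fun t => (t : ℂ))
    rw [hlin, hlin] at this
    simpa [hv] using this
set_option linter.unusedVariables false

lemma exists_minor {d : ℕ} (v w : Fin d → ℤ) (hv : v ≠ 0) (hw : w ≠ 0)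
    (h : Submodule.span ℝ {embed v} ≠ Submodule.span ℝ {embed w}) : ∃ a k, v a * w k - v k * w a ≠ 0 := by
  by_contra hcon
  push Not at hcon
  obtain ⟨a, ha⟩ := Function.ne_iff.1 hv
  have ha' : (v a : ℝ) ≠ 0 := by exact_mod_cast ha
  have e : embed w = ((w a : ℝ) / v a) • embed v := by
    funext k
    have := hcon a k
    have h2 : (v a : ℝ) * w k - v k * w a = 0 := by exact_mod_cast this
    simp only [embed, Pi.smul_apply, smul_eq_mul]
    field_simp
    linarith
  have hwa : (w a : ℝ) ≠ 0 := by
    intro h0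
    rw [h0, zero_div, zero_smul] at e
    apply hw
    funext k
    have := congrFun e k
    simpa [embed] using this
  apply h
  rw [e, Submodule.span_singleton_smul_eq (IsUnit.mk0 _ (div_ne_zero hwa ha'))]

/-- coordinate projection -/
def prj {d : ℕ} (a k : Fin d) : (Fin d → ℝ) →ₗ[ℝ] ℝ × ℝ :=
  (LinearMap.proj a).prod (LinearMap.proj k)

lemma prj_apply {d : ℕ} (a k : Fin d) (x : Fin d → ℝ) : prj a k x = (x a, x k) := rfl

lemma embed_inj {d : ℕ} : Function.Injective (embed : (Fin d → ℤ) → (Fin d → ℝ)) := by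
  intro x y h
  funext i
  have := congrFun h i
  simpa [embed] using this

theorem slice_core {d : ℕ} (v : Fin 7 → Fin d → ℤ) (W : Submodule ℝ (Fin d → ℝ))
    (hW : Module.finrank ℝ W = 2) (hv : ∀ i, v i ≠ 0) (hvW : ∀ i, embed (v i) ∈ W)
    (hne : ∀ i j, i ≠ j → Submodule.span ℝ {embed (v i)} ≠ Submodule.span ℝ {embed (v j)})
    (FF : Bool → Finset (Fin d → ℤ)) (hF : ∀ b, IsConvexLatticeSet (FF b))
    (h : ∀ i, XrayEq (Submodule.span ℝ {embed (v i)}) (embed '' ↑(FF true)) (embed '' ↑(FF false)))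
    {b0 : Bool} {z0 : Fin d → ℤ} (hz : z0 ∈ FF b0) (hz' : z0 ∉ FF (!b0)) : False := by
  classical
  obtain ⟨a, k, hak⟩ := exists_minor (v 0) (v 1) (hv 0) (hv 1) (hne 0 1 (by decide))
  have hakR : (v 0 a : ℝ) * v 1 k - v 0 k * v 1 a ≠ 0 := by exact_mod_cast hak
  set π := prj a k with hπ
  have hsurj : ∀ p : ℝ × ℝ, ∃ w ∈ W, π w = p := by
    intro p
    refine ⟨((p.1 * v 1 k - p.2 * v 1 a) / ((v 0 a : ℝ) * v 1 k - v 0 k * v 1 a)) • embed (v 0)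
      + ((p.2 * v 0 a - p.1 * v 0 k) / ((v 0 a : ℝ) * v 1 k - v 0 k * v 1 a)) • embed (v 1),
      W.add_mem (W.smul_mem _ (hvW 0)) (W.smul_mem _ (hvW 1)), ?_⟩
    rw [hπ, prj_apply]
    ext
    · simp only [embed, Pi.add_apply, Pi.smul_apply, smul_eq_mul]
      rw [div_mul_eq_mul_div, div_mul_eq_mul_div, ← add_div, div_eq_iff hakR]
      ring
    · simp only [embed, Pi.add_apply, Pi.smul_apply, smul_eq_mul]
      rw [div_mul_eq_mul_div, div_mul_eq_mul_div, ← add_div, div_eq_iff hakR]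
      ring
  have hinj : ∀ w ∈ W, π w = 0 → w = 0 := by
    have hs : Function.Surjective (π.domRestrict W) := by
      intro p
      obtain ⟨w, hw, e⟩ := hsurj p
      exact ⟨⟨w, hw⟩, e⟩
    have hi := (LinearMap.injective_iff_surjective_of_finrank_eq_finrank
      (f := π.domRestrict W) (by rw [hW]; simp)).2 hs
    intro w hw h0
    have : (⟨w, hw⟩ : W) = 0 := hi (by rw [map_zero]; exact h0)
    exact congrArg Subtype.val this
  let u : Fin 7 → ℤ × ℤ := fun i => (v i a, v i k)
  have hπv : ∀ i, π (embed (v i)) = (((u i).1 : ℝ), ((u i).2 : ℝ)) := fun i => rfl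
  have hu : ∀ i j, i ≠ j → (u i).1 * (u j).2 - (u i).2 * (u j).1 ≠ 0 := by
    intro i j hij h0
    have h0' : (v i a : ℝ) * v j k - v i k * v j a = 0 := by exact_mod_cast h0
    have g1 := hinj ((v i a : ℝ) • embed (v j) - (v j a : ℝ) • embed (v i))
      (W.sub_mem (W.smul_mem _ (hvW _)) (W.smul_mem _ (hvW _))) (by
        rw [hπ, prj_apply]
        ext
        · simp [embed]; ring
        · simp [embed]; linarith)
    have g2 := hinj ((v i k : ℝ) • embed (v j) - (v j k : ℝ) • embed (v i))
      (W.sub_mem (W.smul_mem _ (hvW _)) (W.smul_mem _ (hvW _))) (by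
        rw [hπ, prj_apply]
        ext
        · simp [embed]; linarith
        · simp [embed]; ring)
    obtain ⟨l, l', hl⟩ := exists_minor (v i) (v j) (hv i) (hv j) (hne i j hij)
    have hl' : (v i l : ℝ) * v j l' - v i l' * v j l ≠ 0 := by exact_mod_cast hl
    have g1l := congrFun g1 l
    have g1l' := congrFun g1 l'
    have g2l := congrFun g2 l
    have g2l' := congrFun g2 l'
    simp only [embed, Pi.sub_apply, Pi.smul_apply, smul_eq_mul, Pi.zero_apply] at g1l g1l' g2l g2l'
    have e1 : (v i a : ℝ) * ((v i l : ℝ) * v j l' - v i l' * v j l) = 0 := by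
      linear_combination v i l * g1l' - v i l' * g1l
    have e2 : (v i k : ℝ) * ((v i l : ℝ) * v j l' - v i l' * v j l) = 0 := by
      linear_combination v i l * g2l' - v i l' * g2l
    have f1 := (mul_eq_zero.1 e1).resolve_right hl'
    have f2 := (mul_eq_zero.1 e2).resolve_right hl'
    have := hinj (embed (v i)) (hvW i) (by
      rw [hπ, prj_apply]; ext
      · exact f1
      · exact f2)
    apply hv i
    apply embed_inj
    rw [this]; funext; simp [embed]
  -- the slices
  let G : Bool → Finset (ℝ × ℝ) := fun b =>
    ((FF b).filter (fun x => embed x - embed z0 ∈ W)).image (fun x => π (embed x))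
  have hπinj : ∀ x y : Fin d → ℝ, x - embed z0 ∈ W → y - embed z0 ∈ W → π x = π y → x = y := by
    intro x y hx hy he
    have h1 : x - y ∈ W := by
      have := W.sub_mem hx hy
      rwa [sub_sub_sub_cancel_right] at this
    have := hinj _ h1 (by rw [map_sub, he, sub_self])
    exact sub_eq_zero.1 this
  have hGmem : ∀ b q, q ∈ G b ↔ ∃ x ∈ FF b, embed x - embed z0 ∈ W ∧ π (embed x) = q := by
    intro b q
    simp only [G, Finset.mem_image, Finset.mem_filter, and_assoc]
  have hcfg : Cfg G (fun b => convexHull ℝ (G b : Set (ℝ × ℝ))) := by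
    refine ⟨fun b => convex_convexHull _ _, fun b x hx => subset_convexHull ℝ _ hx, ?_⟩
    intro b q hq hqK
    obtain ⟨p, hp, hpW, rfl⟩ := (hGmem _ _).1 hq
    have hsetW : Convex ℝ {y : Fin d → ℝ | y - embed z0 ∈ W} := by
      intro x hx y hy s t hs ht hst
      have e : s • x + t • y - embed z0 = s • (x - embed z0) + t • (y - embed z0) := by
        have : embed z0 = (s + t) • embed z0 := by rw [hst, one_smul]
        rw [add_smul] at this
        rw [smul_sub, smul_sub]
        nth_rewrite 1 [this]
        abel
      show s • x + t • y - embed z0 ∈ W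
      rw [e]
      exact W.add_mem (W.smul_mem _ hx) (W.smul_mem _ hy)
    have hGim : (G (!b) : Set (ℝ × ℝ))
        = π '' (embed '' {x | x ∈ FF (!b) ∧ embed x - embed z0 ∈ W}) := by
      ext q
      rw [Finset.mem_coe, hGmem]
      constructor
      · rintro ⟨x, h1, h2, h3⟩
        exact ⟨_, ⟨x, ⟨h1, h2⟩, rfl⟩, h3⟩
      · rintro ⟨_, ⟨x, ⟨h1, h2⟩, rfl⟩, h3⟩
        exact ⟨x, h1, h2, h3⟩
    rw [hGim, ← LinearMap.image_convexHull] at hqK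
    obtain ⟨y, hy, hye⟩ := hqK
    have hy1 : y - embed z0 ∈ W := by
      refine convexHull_min ?_ hsetW hy
      rintro _ ⟨x, ⟨_, h2⟩, rfl⟩
      exact h2
    have hy2 : y ∈ convexHull ℝ (embed '' (FF (!b) : Set (Fin d → ℤ))) := by
      refine convexHull_mono ?_ hy
      rintro _ ⟨x, ⟨h1, _⟩, rfl⟩
      exact ⟨x, h1, rfl⟩
    have hyp : y = embed p := hπinj _ _ hy1 hpW hye
    have h3 : embed p ∈ embed '' (FF (!b) : Set (Fin d → ℤ)) := by
      rw [hF (!b)]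
      exact ⟨hyp ▸ hy2, ⟨p, rfl⟩⟩
    obtain ⟨p', hp', e⟩ := h3
    rw [embed_inj e] at hp'
    exact (hGmem _ _).2 ⟨p, hp', hpW, rfl⟩
  have hXR : ∀ i, XR G (((u i).1 : ℝ), ((u i).2 : ℝ)) := by
    intro i c
    set U : ℝ × ℝ := (((u i).1 : ℝ), ((u i).2 : ℝ)) with hU
    have hU0 : U ≠ 0 := by
      intro h0
      obtain ⟨j, hj⟩ := exists_ne i
      apply hu i j hj.symm
      have h1 : ((u i).1 : ℝ) = 0 := congrArg Prod.fst h0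
      have h2 : ((u i).2 : ℝ) = 0 := congrArg Prod.snd h0
      have h1' : (u i).1 = 0 := by exact_mod_cast h1
      have h2' : (u i).2 = 0 := by exact_mod_cast h2
      rw [h1', h2']; ring
    have hp : 0 < U.1 ^ 2 + U.2 ^ 2 := by
      rcases eq_or_ne U.1 0 with h | h
      · have : U.2 ≠ 0 := fun h' => hU0 (Prod.ext h h')
        positivity
      · positivity
    obtain ⟨y, hyW, hyt⟩ : ∃ y : Fin d → ℝ, y - embed z0 ∈ W ∧ tt U (π y) = c := by
      let s := (c - tt U (π (embed z0))) / (U.1 ^ 2 + U.2 ^ 2)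
      obtain ⟨w, hw, he⟩ := hsurj (-U.2 * s, U.1 * s)
      refine ⟨embed z0 + w, by simpa using hw, ?_⟩
      have hs : s * (U.1 ^ 2 + U.2 ^ 2) = c - tt U (π (embed z0)) := div_mul_cancel₀ _ hp.ne'
      rw [map_add, he]
      simp only [tt] at hs ⊢
      simp only [Prod.fst_add, Prod.snd_add]
      linear_combination hs
    have hiff : ∀ x : Fin d → ℝ, (x - embed z0 ∈ W ∧ tt U (π x) = c) ↔
        x ∈ fiber (Submodule.span ℝ {embed (v i)}) (Submodule.Quotient.mk y) := by
      intro x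
      simp only [fiber, mem_ofPred_eq]
      rw [Submodule.Quotient.eq, Submodule.mem_span_singleton]
      constructor
      · rintro ⟨hx, hxt⟩
        have hxy : x - y ∈ W := by
          have := W.sub_mem hx hyW
          rwa [sub_sub_sub_cancel_right] at this
        have ht : tt U (π (x - y)) = 0 := by
          rw [map_sub]
          simp only [tt, Prod.fst_sub, Prod.snd_sub] at hxt hyt ⊢
          linear_combination hxt - hyt
        refine ⟨ss U (π (x - y)) / (U.1 ^ 2 + U.2 ^ 2), ?_⟩
        rw [← sub_eq_zero]
        apply hinj
        · exact W.sub_mem (W.smul_mem _ (hvW i)) hxy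
        · rw [map_sub, map_smul, hπv i, ← hU, sub_eq_zero]
          simp only [tt, ss] at ht ⊢
          ext
          · simp only [Prod.smul_fst, smul_eq_mul]
            field_simp
            linear_combination U.2 * ht
          · simp only [Prod.smul_snd, smul_eq_mul]
            field_simp
            linear_combination -U.1 * ht
      · rintro ⟨t, ht⟩
        have hx : x = y + t • embed (v i) := by rw [ht]; abel
        subst hx
        constructor
        · have : y + t • embed (v i) - embed z0 = (y - embed z0) + t • embed (v i) := by abel
          rw [this]
          exact W.add_mem hyW (W.smul_mem _ (hvW i))
        · rw [map_add, map_smul, hπv i, ← hU, ← hyt]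
          simp only [tt, Prod.fst_add, Prod.snd_add, Prod.smul_fst, Prod.smul_snd, smul_eq_mul]
          ring
    have hcard : ∀ b, ((G b).filter (fun x => tt U x = c)).card
        = (embed '' (FF b : Set (Fin d → ℤ)) ∩
          fiber (Submodule.span ℝ {embed (v i)}) (Submodule.Quotient.mk y)).ncard := by
      intro b
      have e1 : (embed '' (FF b : Set (Fin d → ℤ)) ∩
          fiber (Submodule.span ℝ {embed (v i)}) (Submodule.Quotient.mk y))
          = (((FF b).filter (fun x => embed x - embed z0 ∈ W ∧ tt U (π (embed x)) = c)).image embed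
            : Finset (Fin d → ℝ)) := by
        ext q
        simp only [Finset.coe_image, mem_inter_iff, mem_image, Finset.mem_coe, Finset.mem_filter]
        constructor
        · rintro ⟨⟨x, hx, rfl⟩, hq⟩
          exact ⟨x, ⟨hx, (hiff _).2 hq⟩, rfl⟩
        · rintro ⟨x, ⟨hx, hq⟩, rfl⟩
          exact ⟨⟨x, hx, rfl⟩, (hiff _).1 hq⟩
      rw [e1, Set.ncard_coe_finset, Finset.card_image_of_injective _ embed_inj]
      have e2 : (G b).filter (fun x => tt U x = c)
          = ((FF b).filter (fun x => embed x - embed z0 ∈ W ∧ tt U (π (embed x)) = c)).image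
            (fun x => π (embed x)) := by
        ext q
        rw [Finset.mem_filter, hGmem]
        simp only [Finset.mem_image, Finset.mem_filter]
        constructor
        · rintro ⟨⟨x, h1, h2, rfl⟩, h3⟩
          exact ⟨x, ⟨h1, h2, h3⟩, rfl⟩
        · rintro ⟨x, ⟨h1, h2, h3⟩, rfl⟩
          exact ⟨⟨x, h1, h2, rfl⟩, h3⟩
      rw [e2, Finset.card_image_of_injOn]
      intro x hx y hy hxy
      have hx' := (Finset.mem_filter.1 hx).2.1
      have hy' := (Finset.mem_filter.1 hy).2.1
      exact embed_inj (hπinj _ _ hx' hy' hxy)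
    rw [hcard true, hcard false]
    exact h i _
  refine planar hcfg u hu hXR (b := b0) (x := π (embed z0)) ?_
  rw [mem_DD]
  constructor
  · exact (hGmem _ _).2 ⟨z0, hz, by simp, rfl⟩
  · intro hmem
    obtain ⟨x, hx, hxW, he⟩ := (hGmem _ _).1 hmem
    have := embed_inj (hπinj _ _ hxW (by simp) he)
    rw [this] at hx
    exact hz' hx

theorem gardner_gritzmann_seven_coplanar_directions
    (d : ℕ) (hd : 2 ≤ d) (𝓛 : Finset (Submodule ℝ (Fin d → ℝ)))
    (h𝓛 : ∀ S ∈ 𝓛, IsLatticeLine S) (hcard : 7 ≤ 𝓛.card)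
    (W : Submodule ℝ (Fin d → ℝ)) (hW : Module.finrank ℝ W = 2)
    (hsub : ∀ S ∈ 𝓛, S ≤ W)
    (F F' : Finset (Fin d → ℤ)) (hF : IsConvexLatticeSet F) (hF' : IsConvexLatticeSet F')
    (h : TomEq (↑𝓛 : Set (Submodule ℝ (Fin d → ℝ))) (embed '' ↑F') (embed '' ↑F)) :
    F' = F := by
  obtain ⟨s⟩ : Nonempty (Fin 7 ↪ 𝓛) := by
    apply Function.Embedding.nonempty_of_card_le
    simpa using hcard
  choose v hv0 hvs using fun i => h𝓛 (s i).1 (s i).2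
  have hvs' : ∀ i, (s i).1 = Submodule.span ℝ {embed (v i)} := hvs
  have main := fun (b0 : Bool) (z0 : Fin d → ℤ) => slice_core (b0 := b0) (z0 := z0) v W hW hv0
    (fun i => hsub _ (s i).2 (by rw [hvs' i]; exact Submodule.mem_span_singleton_self _))
    (fun i j hij he => hij (s.injective (Subtype.ext (by rw [hvs' i, hvs' j, he]))))
    (fun b => if b then F' else F) (by intro b; cases b <;> simp [hF, hF'])
    (by
      intro i
      have := h (s i).1 (s i).2
      rw [hvs' i] at this
      simpa using this)
  ext z
  constructor
  · intro hz
    by_contra hz'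
    exact main true z (by simpa using hz) (by simpa using hz')
  · intro hz
    by_contra hz'
    exact main false z (by simpa using hz) (by simpa using hz')
end

section
/- (Stable Rényi theorem) Let 𝒮 be a finite set of 1-dimensional linear subspaces of ℝ^d and let F₁, F₂ ⊆ ℝ^d be finite sets with Δ_𝒮(F₁, F₂) < 2|F₁|. If either (|F₁| = |F₂| and |F₁| + 1 ≤ |𝒮|) or (|F₁| ≤ |F₂| and 2|F₁| ≤ |𝒮|), then F₁ = F₂. The statement persists when F₁, F₂ ⊆ ℤ^d and 𝒮 consists of lattice lines. -/
open Set

variable {d : ℕ}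

open Classical in
theorem line_bound {d : ℕ} (S : Submodule ℝ (Fin d → ℝ)) (f g : Finset (Fin d → ℝ)) :
    (((f \ g).card : ℤ) + (g \ f).card
      - 2 * (((f \ g) ×ˢ (g \ f)).filter (fun p => p.1 - p.2 ∈ S)).card) ≤
    ((∑ᶠ T : (Fin d → ℝ) ⧸ S,
      ((((f : Set (Fin d → ℝ)) ∩ fiber S T).ncard : ℤ)
        - (((g : Set (Fin d → ℝ)) ∩ fiber S T).ncard : ℤ)).natAbs : ℕ) : ℤ) := by
  set q : (Fin d → ℝ) → ((Fin d → ℝ) ⧸ S) := fun x => Submodule.Quotient.mk x with hq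
  have hc : ∀ (h : Finset (Fin d → ℝ)) T,
      ((h : Set (Fin d → ℝ)) ∩ fiber S T).ncard = (h.filter (fun x => q x = T)).card := by
    intro h T
    rw [← Set.ncard_coe_finset]
    congr 1
    ext x
    simp [fiber, hq]
  simp only [hc]
  set I := (f ∪ g).image q with hI
  rw [finsum_eq_sum_of_support_subset (s := I)]
  swap
  · intro T hT
    by_contra hn
    apply hT
    have hz : ∀ h : Finset (Fin d → ℝ), h ⊆ f ∪ g → h.filter (fun x => q x = T) = ∅ := by
      intro h hh
      rw [Finset.filter_eq_empty_iff]
      intro x hx he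
      exact hn (Finset.mem_coe.2 (Finset.mem_image.2 ⟨x, hh hx, he⟩))
    simp [hz f Finset.subset_union_left, hz g Finset.subset_union_right]
  have hA : (f \ g).card = ∑ T ∈ I, ((f \ g).filter (fun x => q x = T)).card := by
    apply Finset.card_eq_sum_card_fiberwise
    intro x hx
    simp only [Finset.coe_sdiff, Set.mem_sdiff, Finset.mem_coe] at hx
    exact Finset.mem_coe.2 (Finset.mem_image_of_mem q (Finset.mem_union_left _ hx.1))
  have hB : (g \ f).card = ∑ T ∈ I, ((g \ f).filter (fun x => q x = T)).card := by
    apply Finset.card_eq_sum_card_fiberwise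
    intro x hx
    simp only [Finset.coe_sdiff, Set.mem_sdiff, Finset.mem_coe] at hx
    exact Finset.mem_coe.2 (Finset.mem_image_of_mem q (Finset.mem_union_right _ hx.1))
  have hP : (((f \ g) ×ˢ (g \ f)).filter (fun p => p.1 - p.2 ∈ S)).card
      = ∑ T ∈ I, ((f \ g).filter (fun x => q x = T)).card
          * ((g \ f).filter (fun x => q x = T)).card := by
    rw [Finset.card_eq_sum_card_fiberwise (f := fun p => q p.1) (t := I)]
    · apply Finset.sum_congr rfl
      intro T _
      rw [← Finset.card_product]
      congr 1
      ext ⟨x, y⟩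
      have : x - y ∈ S ↔ q x = q y := (Submodule.Quotient.eq S).symm
      simp only [Finset.mem_filter, Finset.mem_product, this]
      constructor
      · rintro ⟨⟨⟨h1, h2⟩, h3⟩, h4⟩
        exact ⟨⟨h1, h4⟩, h2, h3 ▸ h4⟩
      · rintro ⟨⟨h1, h4⟩, h2, h3⟩
        exact ⟨⟨⟨h1, h2⟩, h4.trans h3.symm⟩, h4⟩
    · intro p hp
      have hp' := Finset.mem_coe.1 hp
      simp only [Finset.mem_filter, Finset.mem_product, Finset.mem_sdiff] at hp'
      exact Finset.mem_coe.2 (Finset.mem_image_of_mem q (Finset.mem_union_left _ hp'.1.1.1))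
  rw [hA, hB, hP]
  push_cast
  rw [Finset.mul_sum, ← Finset.sum_add_distrib, ← Finset.sum_sub_distrib]
  apply Finset.sum_le_sum
  intro T _
  have e1 : (f.filter (fun x => q x = T)).card = ((f \ g).filter (fun x => q x = T)).card
      + ((f ∩ g).filter (fun x => q x = T)).card := by
    rw [← Finset.card_union_of_disjoint, ← Finset.filter_union, Finset.sdiff_union_inter]
    exact Finset.disjoint_filter_filter (Finset.disjoint_sdiff_inter f g)
  have e2 : (g.filter (fun x => q x = T)).card = ((g \ f).filter (fun x => q x = T)).card
      + ((f ∩ g).filter (fun x => q x = T)).card := by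
    rw [Finset.inter_comm f g, ← Finset.card_union_of_disjoint, ← Finset.filter_union,
      Finset.sdiff_union_inter]
    exact Finset.disjoint_filter_filter (Finset.disjoint_sdiff_inter g f)
  rw [e1, e2]
  generalize ((f \ g).filter (fun x => q x = T)).card = a
  generalize ((g \ f).filter (fun x => q x = T)).card = b
  push_cast
  rw [add_sub_add_right_eq_sub]
  rcases Nat.eq_zero_or_pos a with rfl | ha
  · simp
  rcases Nat.eq_zero_or_pos b with rfl | hb
  · simp
  have ha' : (1 : ℤ) ≤ a := by exact_mod_cast ha
  have hb' : (1 : ℤ) ≤ b := by exact_mod_cast hb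
  have := abs_nonneg ((a : ℤ) - b)
  nlinarith

open Classical in
theorem total_bound {d : ℕ} (s : Finset (Submodule ℝ (Fin d → ℝ)))
    (hdim : ∀ S ∈ s, Module.finrank ℝ S = 1) (f g : Finset (Fin d → ℝ)) :
    (s.card : ℤ) * ((f \ g).card + (g \ f).card) - 2 * ((f \ g).card * (g \ f).card)
      ≤ (xrayDiff (s : Set (Submodule ℝ (Fin d → ℝ))) (f : Set (Fin d → ℝ)) g : ℤ) := by
  unfold xrayDiff
  rw [finsum_mem_coe_finset]
  rw [Nat.cast_sum]
  refine le_trans ?_ (Finset.sum_le_sum (fun S _ => line_bound S f g))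
  rw [Finset.sum_sub_distrib, Finset.sum_const, nsmul_eq_mul, ← Finset.mul_sum]
  have key : ∑ S ∈ s, (((f \ g) ×ˢ (g \ f)).filter (fun p => p.1 - p.2 ∈ S)).card
      ≤ (f \ g).card * (g \ f).card := by
    rw [← Finset.card_product]
    have := Finset.sum_card_bipartiteAbove_eq_sum_card_bipartiteBelow
      (s := s) (t := (f \ g) ×ˢ (g \ f)) (fun S p => p.1 - p.2 ∈ S)
    unfold Finset.bipartiteAbove Finset.bipartiteBelow at this
    rw [this, Finset.card_eq_sum_ones]
    apply Finset.sum_le_sum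
    rintro ⟨x, y⟩ hp
    simp only [Finset.mem_product, Finset.mem_sdiff] at hp
    have hxy : x - y ≠ 0 := by
      intro h
      rw [sub_eq_zero] at h
      exact hp.2.2 (h ▸ hp.1.1)
    rw [Finset.card_le_one]
    have hs : ∀ S ∈ s, x - y ∈ S → Submodule.span ℝ {x - y} = S := by
      intro S hS hm
      haveI : FiniteDimensional ℝ S := inferInstance
      apply Submodule.eq_of_le_of_finrank_eq
      · rwa [Submodule.span_singleton_le_iff_mem]
      · rw [hdim S hS, finrank_span_singleton hxy]
    intro S hS S' hS'
    simp only [Finset.mem_filter] at hS hS'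
    rw [← hs S hS.1 hS.2, hs S' hS'.1 hS'.2]
  have key' : ∑ S ∈ s, ((((f \ g) ×ˢ (g \ f)).filter (fun p => p.1 - p.2 ∈ S)).card : ℤ)
      ≤ (f \ g).card * (g \ f).card := by exact_mod_cast key
  linarith

theorem stable_renyi
    (d : ℕ) (𝒮 : Set (Submodule ℝ (Fin d → ℝ))) (hfin : 𝒮.Finite)
    (hdim : ∀ S ∈ 𝒮, Module.finrank ℝ S = 1)
    (F₁ F₂ : Set (Fin d → ℝ)) (h₁ : F₁.Finite) (h₂ : F₂.Finite)
    (hΔ : xrayDiff 𝒮 F₁ F₂ < 2 * F₁.ncard)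
    (hcase : (F₁.ncard = F₂.ncard ∧ F₁.ncard + 1 ≤ 𝒮.ncard) ∨
             (F₁.ncard ≤ F₂.ncard ∧ 2 * F₁.ncard ≤ 𝒮.ncard)) :
    F₁ = F₂ := by
  classical
  lift 𝒮 to Finset (Submodule ℝ (Fin d → ℝ)) using hfin
  lift F₁ to Finset (Fin d → ℝ) using h₁
  lift F₂ to Finset (Fin d → ℝ) using h₂
  simp only [Set.ncard_coe_finset] at hΔ hcase
  have hb := total_bound 𝒮 (fun S hS => hdim S (Finset.mem_coe.2 hS)) F₁ F₂
  have c1 := Finset.card_sdiff_add_card_inter F₁ F₂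
  have c2 := Finset.card_sdiff_add_card_inter F₂ F₁
  rw [Finset.inter_comm] at c2
  by_contra hne
  have hpos : 1 ≤ (F₁ \ F₂).card + (F₂ \ F₁).card := by
    by_contra h0
    have z1 : (F₁ \ F₂).card = 0 := by omega
    have z2 : (F₂ \ F₁).card = 0 := by omega
    rw [Finset.card_eq_zero, Finset.sdiff_eq_empty_iff_subset] at z1 z2
    exact hne (by rw [Finset.Subset.antisymm z1 z2])
  have hΔ' : (xrayDiff (𝒮 : Set (Submodule ℝ (Fin d → ℝ))) (F₁ : Set (Fin d → ℝ)) F₂ : ℤ)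
      < 2 * F₁.card := by exact_mod_cast hΔ
  have hlt := lt_of_le_of_lt hb hΔ'
  generalize (F₁ \ F₂).card = k at *
  generalize (F₂ \ F₁).card = l at *
  generalize (F₁ ∩ F₂).card = c at *
  generalize 𝒮.card = m at *
  rw [← c1, ← c2] at hcase
  rw [← c1] at hlt
  clear hb hΔ hΔ' c1 c2
  rcases hcase with ⟨e, hm⟩ | ⟨e, hm⟩
  · obtain rfl : k = l := by omega
    have hk : (1 : ℤ) ≤ k := by exact_mod_cast (by omega : 1 ≤ k)
    have hm' : (k : ℤ) + c + 1 ≤ m := by exact_mod_cast hm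
    have hc : (0 : ℤ) ≤ c := by positivity
    push_cast at hlt
    nlinarith [mul_le_mul_of_nonneg_left hm' (by linarith : (0 : ℤ) ≤ k),
      mul_nonneg (by linarith : (0 : ℤ) ≤ k - 1) hc]
  · have hl : (1 : ℤ) ≤ l := by exact_mod_cast (by omega : 1 ≤ l)
    have hm' : 2 * ((k : ℤ) + c) ≤ m := by exact_mod_cast hm
    have hc : (0 : ℤ) ≤ c := by positivity
    have hk : (0 : ℤ) ≤ k := by positivity
    push_cast at hlt
    have h1 := mul_le_mul_of_nonneg_right hm' (by linarith : (0 : ℤ) ≤ k + l)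
    rcases hk.eq_or_lt with h0 | h0
    · rw [← h0] at h1 hlt
      nlinarith [mul_nonneg (by linarith : (0 : ℤ) ≤ l - 1) hc]
    · have h0' : (1 : ℤ) ≤ k := h0
      nlinarith [mul_nonneg (by linarith : (0 : ℤ) ≤ k - 1) hk,
        mul_nonneg (by linarith : (0 : ℤ) ≤ k - 1) hc,
        mul_nonneg (by linarith : (0 : ℤ) ≤ l) hc]
end
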